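/- arXiv:1708.09483 — 9 statements merged into one kernel-verified Lean document; each statement's English description precedes it below -/
import Mathlib

section
/- Let S be any subset of the set of algebraic numbers α with |α| < 1 such that 0 ∈ S and S is closed under complex conjugation (α ∈ S implies the complex conjugate of α is in S). Then the collection of transcendental functions f ∈ ℤ{z} whose exceptional set S_f equals S is uncountable. -/
open ComplexConjugate

/-- `f : ℂ → ℂ` is, on the open unit ball, the sum of the power series with
integer coefficients `a` (i.e. `f ∈ ℤ{z}` with coefficient sequence `a`). -/
def IsIntSeries (a : ℕ → ℤ) (f : ℂ → ℂ) : Prop :=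
  ∀ z : ℂ, ‖z‖ < 1 → HasSum (fun n => (a n : ℂ) * z ^ n) (f z)

/-- The exceptional set of `f`: algebraic `α` in the open unit ball with `f α` algebraic. -/
def ExcSet (f : ℂ → ℂ) : Set ℂ :=
  {α : ℂ | IsAlgebraic ℚ α ∧ ‖α‖ < 1 ∧ IsAlgebraic ℚ (f α)}

/-- `f` is a transcendental function on the open unit ball: the only polynomial
`P ∈ ℂ[x,y]` with `P(z, f z) = 0` for all `z` in the ball is the zero polynomial. -/
def IsTranscendentalFn (f : ℂ → ℂ) : Prop :=
  ∀ P : MvPolynomial (Fin 2) ℂ,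
    (∀ z : ℂ, ‖z‖ < 1 → MvPolynomial.eval ![z, f z] P = 0) → P = 0

open PowerSeries

/-- The power series `φ` converges absolutely at `z`, with sum `w`. -/
def HasAbsEval (φ : ℂ⟦X⟧) (z w : ℂ) : Prop :=
  Summable (fun n => ‖coeff n φ * z ^ n‖) ∧ HasSum (fun n => coeff n φ * z ^ n) w

namespace HasAbsEval

variable {φ ψ : ℂ⟦X⟧} {z w v : ℂ}

theorem add (hφ : HasAbsEval φ z w) (hψ : HasAbsEval ψ z v) :
    HasAbsEval (φ + ψ) z (w + v) := by
  have h := hφ.2.add hψ.2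
  refine ⟨(hφ.1.add hψ.1).of_nonneg_of_le (fun _ => norm_nonneg _) fun n => ?_, ?_⟩
  · rw [map_add, add_mul]; exact norm_add_le _ _
  · simpa only [map_add, add_mul] using h

theorem mul (hφ : HasAbsEval φ z w) (hψ : HasAbsEval ψ z v) :
    HasAbsEval (φ * ψ) z (w * v) := by
  have key : ∀ n, coeff n (φ * ψ) * z ^ n =
      ∑ kl ∈ Finset.HasAntidiagonal.antidiagonal n,
        (coeff kl.1 φ * z ^ kl.1) * (coeff kl.2 ψ * z ^ kl.2) := by
    intro n
    rw [coeff_mul, Finset.sum_mul]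
    refine Finset.sum_congr rfl fun kl hkl => ?_
    rw [← Finset.HasAntidiagonal.mem_antidiagonal.1 hkl, pow_add]
    ring
  have hs := summable_norm_sum_mul_antidiagonal_of_summable_norm hφ.1 hψ.1
  have ht := tsum_mul_tsum_eq_tsum_sum_antidiagonal_of_summable_norm hφ.1 hψ.1
  simp_rw [← key] at hs ht
  refine ⟨hs, ?_⟩
  rw [← hφ.2.tsum_eq, ← hψ.2.tsum_eq, ht]
  exact hs.of_norm.hasSum

theorem coe_polynomial (p : Polynomial ℂ) (z : ℂ) : HasAbsEval (p : ℂ⟦X⟧) z (p.eval z) := by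
  have h0 : ∀ n ∉ Finset.range (p.natDegree + 1), coeff n (p : ℂ⟦X⟧) * z ^ n = 0 := by
    intro n hn
    rw [Polynomial.coeff_coe, Polynomial.coeff_eq_zero_of_natDegree_lt (by simpa using hn),
      zero_mul]
  refine ⟨summable_of_ne_finset_zero (s := Finset.range (p.natDegree + 1))
    fun n hn => by rw [h0 n hn, norm_zero], ?_⟩
  rw [Polynomial.eval_eq_sum_range]
  simpa only [Polynomial.coeff_coe] using hasSum_sum_of_ne_finset_zero h0

theorem unique (hφ : HasAbsEval φ z w) (hφ' : HasAbsEval φ z v) : w = v :=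
  hφ.2.unique hφ'.2

theorem of_coeff_bound {φ : ℂ⟦X⟧} (C : ℝ) (hC : ∀ n, ‖coeff n φ‖ ≤ C * (n + 1))
    (hz : ‖z‖ < 1) : HasAbsEval φ z (∑' n, coeff n φ * z ^ n) := by
  have hs : Summable fun n : ℕ => C * (n + 1) * ‖z‖ ^ n := by
    have h1 := summable_pow_mul_geometric_of_norm_lt_one 1 (r := ‖z‖) (by simpa using hz)
    have h0 := summable_geometric_of_lt_one (norm_nonneg z) hz
    refine ((h1.add h0).mul_left C).congr fun n => ?_
    simp; ring
  have : Summable (fun n => ‖coeff n φ * z ^ n‖) := by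
    refine hs.of_nonneg_of_le (fun _ => norm_nonneg _) fun n => ?_
    rw [norm_mul, norm_pow]
    gcongr
    exact hC n
  exact ⟨this, this.of_norm.hasSum⟩

/-- A power series whose sum vanishes on the unit ball is zero. -/
theorem eq_zero_of_forall (h : ∀ z : ℂ, ‖z‖ < 1 → HasAbsEval φ z 0) : φ = 0 := by
  have hp : HasFPowerSeriesOnBall (0 : ℂ → ℂ)
      (FormalMultilinearSeries.ofScalars ℂ fun n => coeff n φ) 0 1 := by
    refine ⟨?_, one_pos, fun {y} hy => ?_⟩
    · refine ENNReal.le_of_forall_nnreal_lt fun r hr => ?_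
      refine FormalMultilinearSeries.le_radius_of_summable _ ?_
      have hr1 : ‖((r : ℝ) : ℂ)‖ < 1 := by
        have : r < 1 := by exact_mod_cast hr
        simpa using this
      refine (h _ hr1).1.of_nonneg_of_le (fun _ => by positivity) fun n => ?_
      rw [norm_mul, norm_pow]
      gcongr
      · exact FormalMultilinearSeries.ofScalars_norm (E := ℂ) (fun n => coeff n φ) n |>.le
      · simp
    · have hy' : ‖y‖ < 1 := by
        rw [Metric.mem_eball, edist_zero_right] at hy
        rw [← ofReal_norm, ← ENNReal.ofReal_one] at hy
        exact (ENNReal.ofReal_lt_ofReal_iff one_pos).1 hy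
      simpa [FormalMultilinearSeries.ofScalars_apply_eq, mul_comm] using (h y hy').2
  have h0 := hp.hasFPowerSeriesAt.eq_zero
  ext n
  have := congrArg (fun p => p n (fun _ => 1)) h0
  simpa [FormalMultilinearSeries.ofScalars_apply_eq] using this

end HasAbsEval

theorem hasAbsEval_aeval_mvPolynomial {φ : ℂ⟦X⟧} {z w : ℂ} (h : HasAbsEval φ z w)
    (P : MvPolynomial (Fin 2) ℂ) :
    HasAbsEval (MvPolynomial.aeval ![X, φ] P) z (MvPolynomial.eval ![z, w] P) := by
  induction P using MvPolynomial.induction_on with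
  | C a => simpa [PowerSeries.algebraMap_apply] using HasAbsEval.coe_polynomial (Polynomial.C a) z
  | add p q hp hq => simpa using hp.add hq
  | mul_X p i hp =>
    rw [map_mul, map_mul]
    refine hp.mul ?_
    fin_cases i
    · simpa using HasAbsEval.coe_polynomial Polynomial.X z
    · simpa using h

/-- A rational power series satisfying a polynomial equation in two variables over `ℂ` satisfies
one over `ℚ`. -/
theorem exists_rat_aeval_eq_zero (A : ℚ⟦X⟧) {P : MvPolynomial (Fin 2) ℂ} (hP : P ≠ 0)
    (h : MvPolynomial.aeval ![X, PowerSeries.map (algebraMap ℚ ℂ) A] P = 0) :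
    ∃ Q : MvPolynomial (Fin 2) ℚ, Q ≠ 0 ∧ MvPolynomial.aeval ![X, A] Q = 0 := by
  obtain ⟨m, hm⟩ := MvPolynomial.ne_zero_iff.1 hP
  obtain ⟨l, hl⟩ : ∃ l : Module.Dual ℚ ℂ, l (P.coeff m) ≠ 0 := by
    by_contra! hl
    exact hm ((Module.forall_dual_apply_eq_zero_iff ℚ _).1 hl)
  have key : ∀ R : MvPolynomial (Fin 2) ℂ, ∃ Q : MvPolynomial (Fin 2) ℚ,
      (∀ k, Q.coeff k = l (R.coeff k)) ∧
      ∀ n, coeff n (MvPolynomial.aeval ![X, A] Q) =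
        l (coeff n (MvPolynomial.aeval ![X, PowerSeries.map (algebraMap ℚ ℂ) A] R)) := by
    intro R
    induction R using MvPolynomial.induction_on' with
    | monomial u c =>
      refine ⟨MvPolynomial.monomial u (l c), fun k => ?_, fun n => ?_⟩
      · simp only [MvPolynomial.coeff_monomial]
        split_ifs <;> simp
      · have hmap : (X ^ u 0 * (PowerSeries.map (algebraMap ℚ ℂ) A) ^ u 1 : ℂ⟦X⟧) =
            PowerSeries.map (algebraMap ℚ ℂ) (X ^ u 0 * A ^ u 1) := by
          simp
        rw [MvPolynomial.aeval_monomial, MvPolynomial.aeval_monomial,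
          Finsupp.prod_fintype _ _ (by simp), Finsupp.prod_fintype _ _ (by simp)]
        simp only [Fin.prod_univ_two, Matrix.cons_val_zero, Matrix.cons_val_one, hmap]
        simp only [PowerSeries.algebraMap_apply, coeff_C_mul, coeff_map, Algebra.algebraMap_self,
          RingHom.id_apply]
        rw [mul_comm c, ← Algebra.smul_def, map_smul, smul_eq_mul, mul_comm]
    | add p q hp hq =>
      obtain ⟨p', hp1, hp2⟩ := hp
      obtain ⟨q', hq1, hq2⟩ := hq
      exact ⟨p' + q', fun k => by simp [hp1, hq1], fun n => by simp [hp2, hq2]⟩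
  obtain ⟨Q, hQ1, hQ2⟩ := key P
  refine ⟨Q, fun h0 => hl ?_, ?_⟩
  · rw [← hQ1, h0, MvPolynomial.coeff_zero]
  · ext n
    rw [hQ2, h]
    simp

theorem isAlgebraic_of_aeval_eq_zero {A : ℚ⟦X⟧} {Q : MvPolynomial (Fin 2) ℚ} (hQ : Q ≠ 0)
    (h : MvPolynomial.aeval ![X, A] Q = 0) : IsAlgebraic (Polynomial ℚ) A := by
  let toPoly : MvPolynomial (Fin 2) ℚ →ₐ[ℚ] Polynomial (Polynomial ℚ) :=
    MvPolynomial.aeval ![Polynomial.C Polynomial.X, Polynomial.X]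
  let toMv : Polynomial (Polynomial ℚ) →+* MvPolynomial (Fin 2) ℚ :=
    Polynomial.eval₂RingHom (Polynomial.aeval (MvPolynomial.X 0)).toRingHom (MvPolynomial.X 1)
  have hinv : toMv.comp toPoly.toRingHom = RingHom.id _ := by
    refine MvPolynomial.ringHom_ext (fun r => ?_) fun i => ?_
    · simp [toMv, toPoly, MvPolynomial.algebraMap_eq,
        IsScalarTower.algebraMap_apply ℚ (Polynomial ℚ) (Polynomial (Polynomial ℚ))]
    · fin_cases i <;> simp [toMv, toPoly]
  refine ⟨toPoly Q, fun h0 => hQ ?_, ?_⟩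
  · have := RingHom.congr_fun hinv Q
    simpa [h0] using this.symm
  · rw [← h]
    have : ((Polynomial.aeval A).restrictScalars ℚ).comp toPoly =
        MvPolynomial.aeval (R := ℚ) ![(X : ℚ⟦X⟧), A] := by
      refine MvPolynomial.algHom_ext fun i => ?_
      fin_cases i <;> simp [toPoly, algebraMap_apply']
    exact AlgHom.congr_fun this Q

/-- Only countably many integer power series are algebraic. -/
theorem countable_not_isTranscendentalFn :
    {a : ℕ → ℤ | ∃ f, IsIntSeries a f ∧ ¬ IsTranscendentalFn f}.Countable := by
  have : FaithfulSMul (Polynomial ℚ) ℚ⟦X⟧ := by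
    rw [faithfulSMul_iff_algebraMap_injective]
    intro p q hpq
    simpa [algebraMap_apply'] using hpq
  have : Countable (Polynomial ℚ) := by
    rw [← Cardinal.mk_le_aleph0_iff]
    exact Polynomial.cardinalMk_le_max.trans (by simp)
  have hc := Algebraic.countable (Polynomial ℚ) ℚ⟦X⟧
  refine Set.MapsTo.countable_of_injOn
    (f := fun a : ℕ → ℤ => PowerSeries.mk fun n => (a n : ℚ)) ?_ ?_ hc
  · rintro a ⟨f, hf, hT⟩
    obtain ⟨P, hPf, hP⟩ : ∃ P : MvPolynomial (Fin 2) ℂ,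
        (∀ z : ℂ, ‖z‖ < 1 → MvPolynomial.eval ![z, f z] P = 0) ∧ P ≠ 0 := by
      simpa [IsTranscendentalFn] using hT
    obtain ⟨Q, hQ, hQA⟩ := exists_rat_aeval_eq_zero (PowerSeries.mk fun n => (a n : ℚ)) hP <| by
      refine HasAbsEval.eq_zero_of_forall fun z hz => ?_
      rw [← hPf z hz]
      refine hasAbsEval_aeval_mvPolynomial ?_ P
      have hs : HasSum (fun n => coeff n (PowerSeries.map (algebraMap ℚ ℂ)
          (PowerSeries.mk fun n => (a n : ℚ))) * z ^ n) (f z) := by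
        simpa using hf z hz
      exact ⟨hs.summable.norm, hs⟩
    exact isAlgebraic_of_aeval_eq_zero hQ hQA
  · intro a _ b _ hab
    ext n
    have := congrArg (coeff n) hab
    simpa using this

/-- The coefficients `c` for which `p + c * M` has integer coefficients, found one at a time by
rounding up; here `M` has constant coefficient `1`. -/
noncomputable def roundingCoeff (M p : ℕ → ℝ) (n : ℕ) : ℝ :=
  Int.fract (-(p n + ∑ i : Fin n, roundingCoeff M p i * M (n - i)))
termination_by n
decreasing_by exact i.2

theorem exists_integral_add_mul (M p : ℝ⟦X⟧) (hM : coeff 0 M = 1) :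
    ∃ (c : ℝ⟦X⟧) (h : ℤ⟦X⟧), (∀ n, |coeff n c| ≤ 1) ∧
      PowerSeries.map (Int.castRingHom ℝ) h = p + c * M := by
  let c := roundingCoeff (fun n => coeff n M) (fun n => coeff n p)
  have hc : ∀ n, c n = Int.fract (-(coeff n p + ∑ i : Fin n, c i * coeff (n - i) M)) := by
    intro n
    simp only [c]
    rw [roundingCoeff]
  refine ⟨PowerSeries.mk c,
    PowerSeries.mk fun n => -⌊-(coeff n p + ∑ i : Fin n, c i * coeff (n - i) M)⌋,
    fun n => ?_, ?_⟩
  · rw [coeff_mk, hc, abs_of_nonneg (Int.fract_nonneg _)]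
    exact (Int.fract_lt_one _).le
  · ext n
    rw [map_add, coeff_mul, Finset.Nat.sum_antidiagonal_eq_sum_range_succ_mk,
      Finset.sum_range_succ, Finset.sum_range]
    simp only [coeff_map, coeff_mk, Nat.sub_self, hM, mul_one]
    rw [hc n, Int.fract]
    simp only [map_neg, eq_intCast]
    ring

theorem Polynomial.exists_sum_abs_coeff_le (P : Polynomial ℝ) :
    ∃ B : ℝ, ∀ n, ∑ i ∈ Finset.range n, |P.coeff i| ≤ B := by
  have hs : Summable fun i => |P.coeff i| :=
    summable_of_ne_finset_zero (s := P.support) fun i hi => by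
      rw [Polynomial.notMem_support_iff.1 hi, abs_zero]
  exact ⟨_, fun n => hs.sum_le_tsum _ fun _ _ => abs_nonneg _⟩

theorem abs_coeff_mul_coe_le {c : ℝ⟦X⟧} (hc : ∀ n, |coeff n c| ≤ 1) {P : Polynomial ℝ} {B : ℝ}
    (hB : ∀ n, ∑ i ∈ Finset.range n, |P.coeff i| ≤ B) (n : ℕ) :
    |coeff n (c * (P : ℝ⟦X⟧))| ≤ B := by
  rw [mul_comm, coeff_mul, Finset.Nat.sum_antidiagonal_eq_sum_range_succ_mk]
  refine (Finset.abs_sum_le_sum_abs _ _).trans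
    ((Finset.sum_le_sum fun i _ => ?_).trans (hB (n + 1)))
  rw [abs_mul, Polynomial.coeff_coe]
  exact mul_le_of_le_one_right (abs_nonneg _) (hc _)

/-- The real quadratic polynomial with constant coefficient `1` and roots `α` and `conj α`. -/
noncomputable def conjQuad (α : ℂ) : Polynomial ℝ :=
  1 - Polynomial.C (2 * α.re / Complex.normSq α) * Polynomial.X +
    Polynomial.C (1 / Complex.normSq α) * Polynomial.X ^ 2

theorem coeff_zero_conjQuad (α : ℂ) : (conjQuad α).coeff 0 = 1 := by
  simp [conjQuad, Polynomial.coeff_zero_eq_eval_zero]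

theorem aeval_conjQuad {α : ℂ} (hα : α ≠ 0) (z : ℂ) :
    Polynomial.aeval z (conjQuad α) = (1 - z / α) * (1 - z / conj α) := by
  have hα' : conj α ≠ 0 := by simpa using hα
  have h1 : ((2 * α.re : ℝ) : ℂ) = α + conj α := (Complex.add_conj α).symm
  have h2 : ((Complex.normSq α : ℝ) : ℂ) = α * conj α := (Complex.mul_conj α).symm
  simp only [conjQuad, map_add, map_sub, map_one, map_mul, Polynomial.aeval_C, Polynomial.aeval_X,
    map_pow, Complex.coe_algebraMap, Complex.ofReal_div, h1, h2, Complex.ofReal_one]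
  field_simp
  ring

/-- The complexification of an integer power series. -/
noncomputable abbrev complexify (F : ℤ⟦X⟧) : ℂ⟦X⟧ := PowerSeries.map (Int.castRingHom ℂ) F

theorem hasAbsEval_of_map_eq {h : ℤ⟦X⟧} {c : ℝ⟦X⟧} {p M : Polynomial ℝ}
    (hh : PowerSeries.map (Int.castRingHom ℝ) h = p + c * M) (hc : ∀ n, |coeff n c| ≤ 1)
    {z : ℂ} (hz : ‖z‖ < 1) (hM : Polynomial.aeval z M = 0) :
    HasAbsEval (complexify h) z (Polynomial.aeval z p) := by
  have hpoly : ∀ P : Polynomial ℝ, HasAbsEval (PowerSeries.map Complex.ofRealHom (P : ℝ⟦X⟧)) z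
      (Polynomial.aeval z P) := by
    intro P
    rw [← Polynomial.polynomial_map_coe, Polynomial.aeval_def, ← Polynomial.eval_map]
    exact HasAbsEval.coe_polynomial _ z
  have hcE := HasAbsEval.of_coeff_bound (φ := PowerSeries.map Complex.ofRealHom c) 1
    (fun n => by
      have := hc n
      simp only [coeff_map, Complex.ofRealHom_eq_coe, Complex.norm_real, Real.norm_eq_abs]
      have : (0 : ℝ) ≤ n := n.cast_nonneg
      linarith) hz
  have h1 := (hpoly p).add (hcE.mul (hpoly M))
  rw [hM, mul_zero, add_zero, ← map_mul, ← map_add, ← hh] at h1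
  convert h1 using 1
  ext n
  simp

/-- Bounded integer power series that vanish at the zeros of a given real polynomial `M` take
arbitrary (conjugation-compatible) values of bounded size at a further point. -/
theorem exists_bounded_interpolation {M : Polynomial ℝ} (hM0 : M.coeff 0 = 1) {α : ℂ}
    (hα0 : α ≠ 0) (hα1 : ‖α‖ < 1) :
    ∃ C : ℕ, ∀ s : ℂ, ‖s‖ ≤ 1 → (α.im = 0 → s.im = 0) → ∃ h : ℤ⟦X⟧,
      (∀ n, |coeff n h| ≤ C) ∧
      (∀ z : ℂ, ‖z‖ < 1 → Polynomial.aeval z M = 0 → HasAbsEval (complexify h) z 0) ∧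
      HasAbsEval (complexify h) α (s * Polynomial.aeval α M) := by
  obtain ⟨B, hB⟩ := M.exists_sum_abs_coeff_le
  obtain ⟨B', hB'⟩ := (M * conjQuad α).exists_sum_abs_coeff_le
  have hB0 : 0 ≤ B := by simpa using hB 0
  have hMB : ∀ n, |M.coeff n| ≤ B := fun n =>
    (Finset.single_le_sum (f := fun i => |M.coeff i|) (fun _ _ => abs_nonneg _)
      (Finset.self_mem_range_succ n)).trans (hB (n + 1))
  have hXB : ∀ n, |(Polynomial.X * M).coeff n| ≤ B := by
    rintro (_ | n)
    · simpa using hB0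
    · simpa using hMB n
  set β := |α.im|⁻¹ with hβ
  have hβ0 : 0 ≤ β := by positivity
  refine ⟨⌈(1 + β) * B + β * B + B'⌉₊, fun s hs hsα => ?_⟩
  have hα_re : |α.re| ≤ 1 := (Complex.abs_re_le_norm α).trans hα1.le
  set b := s.im / α.im with hb
  set a := s.re - b * α.re with ha
  have hb_le : |b| ≤ β := by
    rw [hb, abs_div, div_eq_mul_inv]
    exact mul_le_of_le_one_left hβ0 ((Complex.abs_im_le_norm s).trans hs)
  have ha_le : |a| ≤ 1 + β := by
    refine (abs_sub _ _).trans (add_le_add ((Complex.abs_re_le_norm s).trans hs) ?_)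
    rw [abs_mul]
    exact (mul_le_of_le_one_right (abs_nonneg _) hα_re).trans hb_le
  have hab : (a : ℂ) + b * α = s := by
    apply Complex.ext
    · simp [ha]
    · rcases eq_or_ne α.im 0 with h | h
      · simp [hb, h, hsα h]
      · simp [hb, h]
  set p : Polynomial ℝ := Polynomial.C a * M + Polynomial.C b * (Polynomial.X * M) with hp
  have hp_eval : ∀ z : ℂ, Polynomial.aeval z p = (a + b * z) * Polynomial.aeval z M := by
    intro z
    simp [hp]
    ring
  obtain ⟨c, h, hc, hh⟩ := exists_integral_add_mul ((M * conjQuad α : Polynomial ℝ) : ℝ⟦X⟧) p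
    (by rw [Polynomial.coeff_coe, Polynomial.mul_coeff_zero, hM0, coeff_zero_conjQuad, mul_one])
  refine ⟨h, fun n => ?_, fun z hz hMz => ?_, ?_⟩
  · have h1 : ((coeff n h : ℤ) : ℝ) = p.coeff n +
        coeff n (c * ((M * conjQuad α : Polynomial ℝ) : ℝ⟦X⟧)) := by
      have := congrArg (coeff n) hh
      simpa only [coeff_map, map_add, Polynomial.coeff_coe, eq_intCast] using this
    have h2 : |p.coeff n| ≤ (1 + β) * B + β * B := by
      rw [hp, Polynomial.coeff_add, Polynomial.coeff_C_mul, Polynomial.coeff_C_mul]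
      refine (abs_add_le _ _).trans ?_
      rw [abs_mul, abs_mul]
      gcongr
      exacts [hMB n, hXB n]
    have h3 : |((coeff n h : ℤ) : ℝ)| ≤ ⌈(1 + β) * B + β * B + B'⌉₊ := by
      rw [h1]
      exact ((abs_add_le _ _).trans (add_le_add h2 (abs_coeff_mul_coe_le hc hB' n))).trans
        (Nat.le_ceil _)
    exact_mod_cast h3
  · have := hasAbsEval_of_map_eq hh hc hz (by rw [map_mul, hMz, zero_mul])
    rwa [hp_eval, hMz, mul_zero] at this
  · have := hasAbsEval_of_map_eq hh hc hα1 (by rw [map_mul, aeval_conjQuad hα0]; simp [hα0])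
    rwa [hp_eval, hab] at this

theorem exists_real_near (p : Prop) (x u : ℝ) {ε : ℝ} (hε : 0 < ε) :
    ∃ t : ℝ, |t - x| < ε ∧ (IsAlgebraic ℚ t ↔ p) ∧ t ≠ u := by
  by_cases hp : p
  · obtain ⟨q, hq1, hq2⟩ := exists_rat_btwn (show x < x + ε by linarith)
    obtain ⟨r, hr1, hr2⟩ := exists_rat_btwn hq2
    have hqa : IsAlgebraic ℚ (q : ℝ) := isAlgebraic_algebraMap q
    have hra : IsAlgebraic ℚ (r : ℝ) := isAlgebraic_algebraMap r
    rcases eq_or_ne (q : ℝ) u with h | h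
    · exact ⟨r, by rw [abs_lt]; constructor <;> linarith, by simp [hp, hra], (h ▸ hr1).ne'⟩
    · exact ⟨q, by rw [abs_lt]; constructor <;> linarith, by simp [hp, hqa], h⟩
  · have hd : Dense ({t : ℝ | IsAlgebraic ℚ t} ∪ {u})ᶜ :=
      ((Algebraic.countable ℚ ℝ).union (Set.countable_singleton u)).dense_compl ℝ
    obtain ⟨t, ht, htx⟩ := hd.exists_dist_lt x hε
    rw [dist_comm, Real.dist_eq] at htx
    simp only [Set.mem_compl_iff, Set.mem_union, Set.mem_ofPred_eq, Set.mem_singleton_iff,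
      not_or] at ht
    exact ⟨t, htx, by simp [hp, ht.1], ht.2⟩

/-- Both algebraic and transcendental numbers are dense, also relative to the real line and after
removing a point. -/
theorem exists_complex_near (p : Prop) (v u : ℂ) {ε : ℝ} (hε : 0 < ε) :
    ∃ w : ℂ, ‖w - v‖ < ε ∧ (v.im = 0 → w.im = 0) ∧ (IsAlgebraic ℚ w ↔ p) ∧ w ≠ u := by
  obtain ⟨t, ht, htp, htu⟩ := exists_real_near p v.re u.re (half_pos hε)
  obtain ⟨q, hq, hq0⟩ : ∃ q : ℚ, |(q : ℝ) - v.im| < ε / 2 ∧ (v.im = 0 → q = 0) := by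
    rcases eq_or_ne v.im 0 with h | h
    · exact ⟨0, by simpa [h] using hε, fun _ => rfl⟩
    · obtain ⟨q, hq⟩ := exists_rat_near v.im (half_pos hε)
      exact ⟨q, by rwa [abs_sub_comm], fun h' => absurd h' h⟩
  have hI : IsAlgebraic ℚ ((q : ℂ) * Complex.I) :=
    (isAlgebraic_algebraMap (R := ℚ) (A := ℂ) q).mul Complex.isIntegral_rat_I.isAlgebraic
  refine ⟨t + q * Complex.I, ?_, fun h => by simp [hq0 h], ?_, fun h => htu ?_⟩
  · refine (Complex.norm_le_abs_re_add_abs_im _).trans_lt ?_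
    simp only [Complex.sub_re, Complex.add_re, Complex.sub_im, Complex.add_im]
    simp
    linarith
  · rw [← htp, ← isAlgebraic_algebraMap_iff (R := ℚ) (A := ℂ) (algebraMap ℝ ℂ).injective]
    constructor
    · intro h
      simpa using h.sub hI
    · intro h
      exact h.add hI
  · simp [← h]

/-- The sum of an integer power series. -/
noncomputable def intEval (F : ℤ⟦X⟧) (z : ℂ) : ℂ := ∑' n, ((coeff n F : ℤ) : ℂ) * z ^ n

theorem intEval_conj (F : ℤ⟦X⟧) (z : ℂ) : intEval F (conj z) = conj (intEval F z) := by
  rw [intEval, intEval, Complex.conj_tsum]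
  simp

theorem hasAbsEval_complexify {F : ℤ⟦X⟧} (hF : ∀ n, |coeff n F| ≤ n + 1) {z : ℂ} (hz : ‖z‖ < 1) :
    HasAbsEval (complexify F) z (intEval F z) := by
  have := HasAbsEval.of_coeff_bound (φ := complexify F) 1 (fun n => by
    have : |((coeff n F : ℤ) : ℝ)| ≤ n + 1 := by exact_mod_cast hF n
    simpa using this) hz
  simpa [intEval] using this

/-- Integer power series with bounded coefficients that moreover satisfy a fixed linear bound. -/
def IsTame (F : ℤ⟦X⟧) : Prop :=
  (∃ D : ℕ, ∀ n, |coeff n F| ≤ D) ∧ ∀ n, |coeff n F| ≤ n + 1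

theorem IsTame.exists_adjust {F : ℤ⟦X⟧} (hF : IsTame F) {M : Polynomial ℝ} (hM0 : M.coeff 0 = 1)
    {α : ℂ} (hα0 : α ≠ 0) (hα1 : ‖α‖ < 1) (hMα : Polynomial.aeval α M ≠ 0) (m : ℕ) (p : Prop)
    (u : ℂ) :
    ∃ F' : ℤ⟦X⟧, IsTame F' ∧ (∀ n < m, coeff n F' = coeff n F) ∧
      (∀ z : ℂ, ‖z‖ < 1 → Polynomial.aeval z M = 0 → intEval F' z = intEval F z) ∧
      (IsAlgebraic ℚ (intEval F' α) ↔ p) ∧ intEval F' α ≠ u := by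
  obtain ⟨⟨D, hD⟩, hlin⟩ := hF
  obtain ⟨C, hC⟩ := exists_bounded_interpolation hM0 hα0 hα1
  let N := m + C + D
  set d := α ^ N * Polynomial.aeval α M with hd
  have hd0 : d ≠ 0 := mul_ne_zero (pow_ne_zero _ hα0) hMα
  obtain ⟨w, hw, hwim, hwp, hwu⟩ := exists_complex_near p (intEval F α) u (norm_pos_iff.2 hd0)
  obtain ⟨h, hh, hhM, hhα⟩ := hC ((w - intEval F α) / d)
    (by rw [norm_div]; exact (div_le_one (norm_pos_iff.2 hd0)).2 hw.le) (by
      intro him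
      have hconj : conj α = α := Complex.conj_eq_iff_im.2 him
      have hF_conj : conj (intEval F α) = intEval F α := by rw [← intEval_conj, hconj]
      have hw_conj : conj w = w :=
        Complex.conj_eq_iff_im.2 (hwim (Complex.conj_eq_iff_im.1 hF_conj))
      have hM_conj : conj (Polynomial.aeval α M) = Polynomial.aeval α M := by
        rw [← Polynomial.aeval_conj, hconj]
      rw [← Complex.conj_eq_iff_im, hd]
      simp only [map_div₀, map_sub, map_mul, map_pow, hconj, hF_conj, hw_conj, hM_conj])
  have hcoeff : ∀ n, coeff n (F + X ^ N * h) =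
      coeff n F + if N ≤ n then coeff (n - N) h else 0 := by
    intro n
    rw [map_add, coeff_X_pow_mul']
  have hC0 : (0 : ℤ) ≤ C := Int.natCast_nonneg C
  have htame : IsTame (F + X ^ N * h) := by
    refine ⟨⟨D + C, fun n => ?_⟩, fun n => ?_⟩
    · rw [hcoeff]
      refine (abs_add_le _ _).trans ?_
      push_cast
      refine add_le_add (hD n) ?_
      split_ifs
      · exact hh _
      · simp
    · rw [hcoeff]
      split_ifs with hn
      · have h1 : ((m + C + D : ℕ) : ℤ) ≤ n := by exact_mod_cast hn
        have h2 := abs_add_le (coeff n F) (coeff (n - N) h)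
        have h3 := hD n
        have h4 := hh (n - N)
        push_cast at h1
        linarith [Int.natCast_nonneg m]
      · simpa using hlin n
  have heval : ∀ {z v : ℂ}, ‖z‖ < 1 → HasAbsEval (complexify h) z v →
      intEval (F + X ^ N * h) z = intEval F z + z ^ N * v := by
    intro z v hz hv
    refine (hasAbsEval_complexify htame.2 hz).unique ?_
    have hX : HasAbsEval (X ^ N : ℂ⟦X⟧) z (z ^ N) := by
      simpa using HasAbsEval.coe_polynomial (Polynomial.X ^ N) z
    simpa [complexify] using (hasAbsEval_complexify hlin hz).add (hX.mul hv)
  have hval : intEval (F + X ^ N * h) α = w := by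
    rw [heval hα1 hhα, mul_left_comm, ← hd, div_mul_cancel₀ _ hd0]
    ring
  refine ⟨F + X ^ N * h, htame, fun n hn => ?_, fun z hz hMz => ?_, ?_, ?_⟩
  · rw [hcoeff, if_neg (by omega), add_zero]
  · rw [heval hz (hhM z hz hMz), mul_zero, add_zero]
  · rwa [hval]
  · rwa [hval]

/-- Integer power series whose value at every point of a given sequence in the closed upper half
of the unit ball is algebraic or transcendental as prescribed, and avoids a given number. -/
theorem exists_intSeries_prescribed {α : ℕ → ℂ} (hinj : Function.Injective α)
    (h0 : ∀ k, α k ≠ 0) (h1 : ∀ k, ‖α k‖ < 1) (him : ∀ k, 0 ≤ (α k).im)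
    (p : ℕ → Prop) (u : ℕ → ℂ) :
    ∃ F : ℤ⟦X⟧, (∀ n, |coeff n F| ≤ n + 1) ∧
      ∀ k, (IsAlgebraic ℚ (intEval F (α k)) ↔ p k) ∧ intEval F (α k) ≠ u k := by
  let M : ℕ → Polynomial ℝ := fun k => ∏ i ∈ Finset.range k, conjQuad (α i)
  have hM0 : ∀ k, (M k).coeff 0 = 1 := by
    intro k
    simp only [M, Polynomial.coeff_zero_prod, coeff_zero_conjQuad, Finset.prod_const_one]
  have hMroot : ∀ k, ∀ i < k, Polynomial.aeval (α i) (M k) = 0 := by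
    intro k i hik
    rw [map_prod]
    refine Finset.prod_eq_zero (Finset.mem_range.2 hik) ?_
    rw [aeval_conjQuad (h0 i), div_self (h0 i), sub_self, zero_mul]
  have hMne : ∀ k, Polynomial.aeval (α k) (M k) ≠ 0 := by
    intro k
    rw [map_prod]
    refine Finset.prod_ne_zero_iff.2 fun i hi => ?_
    have hne : α k ≠ α i := fun h => (Finset.mem_range.1 hi).ne' (hinj h)
    have hi0 : conj (α i) ≠ 0 := by simpa using h0 i
    rw [aeval_conjQuad (h0 i)]
    refine mul_ne_zero (fun h => hne ?_) fun h => hne ?_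
    · rwa [sub_eq_zero, eq_comm, div_eq_one_iff_eq (h0 i)] at h
    · rw [sub_eq_zero, eq_comm, div_eq_one_iff_eq hi0] at h
      have him' := congrArg Complex.im h
      rw [Complex.conj_im] at him'
      have hz : (α i).im = 0 := by linarith [him i, him k]
      rw [h, Complex.conj_eq_iff_im.2 hz]
  choose! step hstep using fun (k : ℕ) (F : ℤ⟦X⟧) (hF : IsTame F) =>
    hF.exists_adjust (hM0 k) (h0 k) (h1 k) (hMne k) k (p k) (u k)
  let G : ℕ → ℤ⟦X⟧ := fun k => Nat.rec 0 (fun k F => step k F) k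
  have hGs : ∀ k, G (k + 1) = step k (G k) := fun k => rfl
  have hG : ∀ k, IsTame (G k) := by
    intro k
    induction k with
    | zero => exact ⟨⟨0, fun n => by simp [G]⟩, fun n => by simp [G]; positivity⟩
    | succ k ih => rw [hGs]; exact (hstep k _ ih).1
  have hcoeff : ∀ n k, n + 1 ≤ k → coeff n (G k) = coeff n (G (n + 1)) := by
    intro n k hk
    induction k, hk using Nat.le_induction with
    | base => rfl
    | succ k hk ih => rw [hGs, (hstep k _ (hG k)).2.1 n (by omega), ih]
  have hvalue : ∀ i k, i + 1 ≤ k → intEval (G k) (α i) = intEval (G (i + 1)) (α i) := by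
    intro i k hk
    induction k, hk using Nat.le_induction with
    | base => rfl
    | succ k hk ih =>
      rw [hGs, (hstep k _ (hG k)).2.2.1 _ (h1 i) (hMroot k i (by omega)), ih]
  let F : ℤ⟦X⟧ := PowerSeries.mk fun n => coeff n (G (n + 1))
  have hF : ∀ n, |coeff n F| ≤ n + 1 := fun n => by
    simpa only [F, coeff_mk] using (hG (n + 1)).2 n
  have hlim : ∀ i, intEval F (α i) = intEval (G (i + 1)) (α i) := by
    intro i
    have hbound : Summable fun n : ℕ => ((n : ℝ) + 1) * ‖α i‖ ^ n := by
      have h1' := summable_pow_mul_geometric_of_norm_lt_one 1 (r := ‖α i‖) (by simpa using h1 i)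
      have h0' := summable_geometric_of_lt_one (norm_nonneg (α i)) (h1 i)
      refine (h1'.add h0').congr fun n => ?_
      simp; ring
    have ht : Filter.Tendsto (fun k => intEval (G k) (α i)) Filter.atTop
        (nhds (intEval F (α i))) := by
      refine tendsto_tsum_of_dominated_convergence hbound (fun n => ?_) (.of_forall fun k n => ?_)
      · refine tendsto_const_nhds.congr' ?_
        filter_upwards [Filter.eventually_ge_atTop (n + 1)] with k hk
        rw [hcoeff n k hk, coeff_mk]
      · have : |((coeff n (G k) : ℤ) : ℝ)| ≤ n + 1 := by exact_mod_cast (hG k).2 n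
        rw [norm_mul, norm_pow, Complex.norm_intCast]
        gcongr
    refine tendsto_nhds_unique ht (tendsto_const_nhds.congr' ?_)
    filter_upwards [Filter.eventually_ge_atTop (i + 1)] with k hk
    exact (hvalue i k hk).symm
  refine ⟨F, hF, fun k => ?_⟩
  rw [hlim, hGs]
  exact (hstep k _ (hG k)).2.2.2

theorem IsAlgebraic.complex_conj_iff {z : ℂ} : IsAlgebraic ℚ (conj z) ↔ IsAlgebraic ℚ z :=
  isAlgebraic_algHom_iff (Complex.conjAe.toAlgHom.restrictScalars ℚ) Complex.conjAe.injective

/-- There is an enumeration of the nonzero algebraic numbers in the upper half of the unit ball. -/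
theorem exists_enumeration_algebraic :
    ∃ α : ℕ → ℂ, Function.Injective α ∧
      Set.range α = {z : ℂ | IsAlgebraic ℚ z ∧ z ≠ 0 ∧ ‖z‖ < 1 ∧ 0 ≤ z.im} := by
  set U := {z : ℂ | IsAlgebraic ℚ z ∧ z ≠ 0 ∧ ‖z‖ < 1 ∧ 0 ≤ z.im} with hU
  have hc : U.Countable := (Algebraic.countable ℚ ℂ).mono fun z hz => hz.1
  have hi : U.Infinite := by
    refine Set.infinite_of_injective_forall_mem (f := fun n : ℕ => ((n + 2 : ℚ)⁻¹ : ℂ)) ?_ ?_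
    · intro m n hmn
      simpa using hmn
    · intro n
      have hpos : (0 : ℝ) < n + 2 := by positivity
      have hcast : (((n : ℚ) + 2 : ℚ)⁻¹ : ℂ) = (((n : ℝ) + 2)⁻¹ : ℝ) := by push_cast; rfl
      have hne : ((n : ℂ) + 2) ≠ 0 := by exact_mod_cast (by omega : n + 2 ≠ 0)
      refine ⟨?_, ?_, ?_, ?_⟩
      · simpa using isAlgebraic_algebraMap (R := ℚ) (A := ℂ) ((n : ℚ) + 2)⁻¹
      · simpa using hne
      · rw [hcast, Complex.norm_real, Real.norm_of_nonneg (by positivity)]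
        exact inv_lt_one_of_one_lt₀ (by linarith)
      · rw [hcast, Complex.ofReal_im]
  have := hc.to_subtype
  have := hi.to_subtype
  obtain ⟨e⟩ := nonempty_denumerable U
  refine ⟨fun n => ((Denumerable.eqv U).symm n : ℂ),
    Subtype.val_injective.comp (Denumerable.eqv U).symm.injective, ?_⟩
  ext z
  simp only [Set.mem_range]
  constructor
  · rintro ⟨n, rfl⟩
    exact ((Denumerable.eqv U).symm n).2
  · intro hz
    exact ⟨Denumerable.eqv U ⟨z, hz⟩, by simp⟩

theorem exists_intSeries_excSet_eq {S : Set ℂ} (hS : ∀ α ∈ S, IsAlgebraic ℚ α ∧ ‖α‖ < 1)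
    (h0 : (0 : ℂ) ∈ S) (hconj : ∀ α ∈ S, conj α ∈ S) (u : ℕ → ℕ → ℤ) :
    ∃ a f, IsIntSeries a f ∧ ExcSet f = S ∧ ∀ k, a ≠ u k := by
  obtain ⟨α, hinj, hrange⟩ := exists_enumeration_algebraic
  have hα : ∀ k, IsAlgebraic ℚ (α k) ∧ α k ≠ 0 ∧ ‖α k‖ < 1 ∧ 0 ≤ (α k).im := by
    intro k
    have : α k ∈ Set.range α := ⟨k, rfl⟩
    rwa [hrange] at this
  obtain ⟨F, hF, hval⟩ := exists_intSeries_prescribed hinj (fun k => (hα k).2.1)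
    (fun k => (hα k).2.2.1) (fun k => (hα k).2.2.2) (fun k => α k ∈ S)
    (fun k => intEval (PowerSeries.mk (u k)) (α k))
  have hconj_iff : ∀ z, conj z ∈ S ↔ z ∈ S := fun z =>
    ⟨fun h => by simpa using hconj _ h, hconj z⟩
  have hupper : ∀ z : ℂ, IsAlgebraic ℚ z → z ≠ 0 → ‖z‖ < 1 → 0 ≤ z.im →
      (IsAlgebraic ℚ (intEval F z) ↔ z ∈ S) := by
    intro z hz hz0 hz1 him
    obtain ⟨k, rfl⟩ : z ∈ Set.range α := by rw [hrange]; exact ⟨hz, hz0, hz1, him⟩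
    exact (hval k).1
  have hall : ∀ z : ℂ, IsAlgebraic ℚ z → ‖z‖ < 1 → (IsAlgebraic ℚ (intEval F z) ↔ z ∈ S) := by
    intro z hz hz1
    rcases eq_or_ne z 0 with rfl | hz0
    · have hzero : intEval F 0 = ((coeff 0 F : ℤ) : ℂ) := by
        rw [intEval, tsum_eq_single 0 fun n hn => by simp [hn]]
        simp
      rw [hzero]
      exact iff_of_true (isAlgebraic_intCast _) h0
    · rcases le_total 0 z.im with him | him
      · exact hupper z hz hz0 hz1 him
      · rw [← hconj_iff, ← hupper (conj z) (IsAlgebraic.complex_conj_iff.2 hz) (by simpa using hz0)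
          (by simpa using hz1) (by simpa using him), intEval_conj, IsAlgebraic.complex_conj_iff]
  refine ⟨fun n => coeff n F, intEval F, fun z hz => ?_, ?_, fun k hk => (hval k).2 ?_⟩
  · simpa using (hasAbsEval_complexify hF hz).2
  · ext z
    constructor
    · rintro ⟨hz, hz1, hfz⟩
      exact (hall z hz hz1).1 hfz
    · intro hz
      obtain ⟨hz', hz1⟩ := hS z hz
      exact ⟨hz', hz1, (hall z hz' hz1).2 hz⟩
  · congr 1
    ext n
    rw [← hk, coeff_mk]

theorem uncountably_many_transcendental_with_exceptional_set (S : Set ℂ)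
    (hS : ∀ α ∈ S, IsAlgebraic ℚ α ∧ ‖α‖ < 1)
    (h0 : (0 : ℂ) ∈ S)
    (hconj : ∀ α ∈ S, conj α ∈ S) :
    ¬ Set.Countable {a : ℕ → ℤ | ∃ f : ℂ → ℂ,
        IsIntSeries a f ∧ IsTranscendentalFn f ∧ ExcSet f = S} := by
  intro hc
  have hc' := hc.union countable_not_isTranscendentalFn
  obtain ⟨u, hu⟩ := hc'.exists_eq_range <| by
    obtain ⟨a, f, hf, hfS, -⟩ := exists_intSeries_excSet_eq hS h0 hconj 0
    by_cases hT : IsTranscendentalFn f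
    · exact ⟨a, .inl ⟨f, hf, hT, hfS⟩⟩
    · exact ⟨a, .inr ⟨f, hf, hT⟩⟩
  obtain ⟨a, f, hf, hfS, hne⟩ := exists_intSeries_excSet_eq hS h0 hconj u
  have ha : a ∈ Set.range u := by
    rw [← hu]
    by_cases hT : IsTranscendentalFn f
    · exact .inl ⟨f, hf, hT, hfS⟩
    · exact .inr ⟨f, hf, hT⟩
  obtain ⟨k, hk⟩ := ha
  exact hne k hk.symm
end

section
/- Let α, β ∈ ℂ with |α| < 1, |β| < 1, and β different from both α and the complex conjugate of α. Then there exists a function f ∈ ℤ{z} such that f(α) = 0 and f(β) ≠ 0, and moreover there exists a constant C > 0 (depending on α and β) such that |f(z)| ≤ C/(1 − |z|) for all z with |z| < 1. -/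
open ComplexConjugate

/-- The representative of `x` modulo `1` whose sign is that of `w`: it lies in `[0, 1)` if `0 ≤ w`,
and in `[-1, 0)` otherwise. -/
noncomputable def signedFract (w x : ℝ) : ℝ :=
  if 0 ≤ w then Int.fract x else Int.fract x - 1

lemma abs_signedFract_le_one (w x : ℝ) : |signedFract w x| ≤ 1 := by
  have h0 := Int.fract_nonneg x
  have h1 := Int.fract_lt_one x
  unfold signedFract
  split_ifs <;> rw [abs_le] <;> constructor <;> linarith

lemma signedFract_mul_nonneg (w x : ℝ) : 0 ≤ signedFract w x * w := by
  have h0 := Int.fract_nonneg x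
  have h1 := Int.fract_lt_one x
  unfold signedFract
  split_ifs with hw
  · positivity
  · exact mul_nonneg_of_nonpos_of_nonpos (by linarith) (by linarith)

lemma exists_int_eq_signedFract_sub (w x : ℝ) : ∃ k : ℤ, (k : ℝ) = signedFract w x - x := by
  have h := Int.self_sub_floor x
  unfold signedFract
  split_ifs
  · exact ⟨-⌊x⌋, by push_cast; linarith⟩
  · exact ⟨-⌊x⌋ - 1, by push_cast; linarith⟩

/-- Real coefficients with prescribed signs `w` such that the power series they define becomes
integral after multiplication by `1 - s z + t z ^ 2`. -/
noncomputable def cofactorCoeff (w : ℕ → ℝ) (s t : ℝ) : ℕ → ℝ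
  | 0 => 1
  | 1 => signedFract (w 1) s
  | n + 2 => signedFract (w (n + 2)) (s * cofactorCoeff w s t (n + 1) - t * cofactorCoeff w s t n)

lemma abs_cofactorCoeff_le_one (w : ℕ → ℝ) (s t : ℝ) (n : ℕ) : |cofactorCoeff w s t n| ≤ 1 := by
  match n with
  | 0 => simp [cofactorCoeff]
  | 1 => exact abs_signedFract_le_one _ _
  | n + 2 => rw [cofactorCoeff]; exact abs_signedFract_le_one _ _

lemma cofactorCoeff_mul_nonneg (w : ℕ → ℝ) (hw : 0 ≤ w 0) (s t : ℝ) (n : ℕ) :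
    0 ≤ cofactorCoeff w s t n * w n := by
  match n with
  | 0 => simpa [cofactorCoeff] using hw
  | 1 => exact signedFract_mul_nonneg _ _
  | n + 2 => rw [cofactorCoeff]; exact signedFract_mul_nonneg _ _

lemma exists_int_eq_cofactorCoeff_mul (w : ℕ → ℝ) (s t : ℝ) :
    ∃ a : ℕ → ℤ, a 0 = 1 ∧ (a 1 : ℝ) = cofactorCoeff w s t 1 - s ∧
      ∀ n, (a (n + 2) : ℝ) = cofactorCoeff w s t (n + 2) - s * cofactorCoeff w s t (n + 1)
        + t * cofactorCoeff w s t n := by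
  obtain ⟨k, hk⟩ := exists_int_eq_signedFract_sub (w 1) s
  choose b hb using fun n => exists_int_eq_signedFract_sub (w (n + 2))
    (s * cofactorCoeff w s t (n + 1) - t * cofactorCoeff w s t n)
  refine ⟨fun n => match n with
    | 0 => 1
    | 1 => k
    | n + 2 => b n, rfl, hk, fun n => ?_⟩
  change (b n : ℝ) = _
  rw [hb n, cofactorCoeff]
  ring

lemma summable_mul_pow_of_abs_le_one {c : ℕ → ℝ} (hc : ∀ n, |c n| ≤ 1) {z : ℂ} (hz : ‖z‖ < 1) :
    Summable fun n => (c n : ℂ) * z ^ n := by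
  refine Summable.of_norm_bounded (summable_geometric_of_lt_one (norm_nonneg z) hz) fun n => ?_
  rw [norm_mul, norm_pow, Complex.norm_real]
  exact mul_le_of_le_one_left (by positivity) (hc n)

lemma norm_tsum_mul_pow_le {c : ℕ → ℝ} (hc : ∀ n, |c n| ≤ 1) {z : ℂ} (hz : ‖z‖ < 1) :
    ‖∑' n, (c n : ℂ) * z ^ n‖ ≤ (1 - ‖z‖)⁻¹ := by
  refine tsum_of_norm_bounded (hasSum_geometric_of_lt_one (norm_nonneg z) hz) fun n => ?_
  rw [norm_mul, norm_pow, Complex.norm_real]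
  exact mul_le_of_le_one_left (by positivity) (hc n)

lemma hasSum_mul_quadratic {c a : ℕ → ℂ} {s t z S : ℂ} (h : HasSum (fun n => c n * z ^ n) S)
    (a0 : a 0 = c 0) (a1 : a 1 = c 1 - s * c 0)
    (a2 : ∀ n, a (n + 2) = c (n + 2) - s * c (n + 1) + t * c n) :
    HasSum (fun n => a n * z ^ n) (S * (1 - s * z + t * z ^ 2)) := by
  rw [← hasSum_nat_add_iff' 2]
  convert (((hasSum_nat_add_iff' 2).2 h).sub (((hasSum_nat_add_iff' 1).2 h).mul_left (s * z))).add
    (h.mul_left (t * z ^ 2)) using 1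
  · ext n
    rw [a2]
    ring
  · simp only [Finset.sum_range_succ, Finset.sum_range_zero, a0, a1]
    ring

/-- If `c n` has the sign of `Re (z ^ n)` for all `n` and `c 0 = 1`, then the power series with
coefficients `c` does not vanish at `z`. -/
lemma tsum_mul_pow_ne_zero {c : ℕ → ℝ} (h0 : c 0 = 1) {z : ℂ}
    (hs : Summable fun n => (c n : ℂ) * z ^ n) (hc : ∀ n, 0 ≤ c n * (z ^ n).re) :
    ∑' n, (c n : ℂ) * z ^ n ≠ 0 := by
  intro h
  have hre := Complex.hasSum_re hs.hasSum
  rw [h] at hre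
  simp only [Complex.re_ofReal_mul] at hre
  have := le_hasSum hre 0 fun n _ => hc n
  norm_num [h0] at this

theorem exists_intSeries_vanishing_at_alpha_not_beta (α β : ℂ)
    (hα : ‖α‖ < 1) (hβ : ‖β‖ < 1) (h1 : β ≠ α) (h2 : β ≠ conj α) :
    ∃ (a : ℕ → ℤ) (f : ℂ → ℂ), IsIntSeries a f ∧ f α = 0 ∧ f β ≠ 0 ∧
      ∃ C : ℝ, 0 < C ∧ ∀ z : ℂ, ‖z‖ < 1 → ‖f z‖ ≤ C / (1 - ‖z‖) := by
  rcases eq_or_ne α 0 with rfl | h0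
  · refine ⟨Pi.single 1 1, id, fun z _ => ?_, rfl, h1, 1, one_pos, fun z hz => ?_⟩
    · convert hasSum_single (f := fun n => (((Pi.single 1 1 : ℕ → ℤ) n : ℤ) : ℂ) * z ^ n) 1
        (fun n hn => by simp [hn]) using 1
      simp
    · rw [id, le_div_iff₀ (by linarith)]
      nlinarith [norm_nonneg z]
  have h0' : conj α ≠ 0 := by simpa using h0
  set s : ℝ := (1 / α + 1 / conj α).re
  set t : ℝ := (1 / α * (1 / conj α)).re
  have hs : (s : ℂ) = 1 / α + 1 / conj α :=
    Complex.conj_eq_iff_re.1 (by simp [add_comm])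
  have ht : (t : ℂ) = 1 / α * (1 / conj α) :=
    Complex.conj_eq_iff_re.1 (by simp [mul_comm])
  have hP (z : ℂ) : 1 - s * z + t * z ^ 2 = (z - α) * (z - conj α) / (α * conj α) := by
    rw [hs, ht]
    field_simp
    ring
  set w : ℕ → ℝ := fun n => (β ^ n).re
  obtain ⟨a, a0, a1, a2⟩ := exists_int_eq_cofactorCoeff_mul w s t
  have hc := abs_cofactorCoeff_le_one w s t
  have hc0 : cofactorCoeff w s t 0 = 1 := by rw [cofactorCoeff]
  refine ⟨a, fun z => (∑' n, (cofactorCoeff w s t n : ℂ) * z ^ n) * (1 - s * z + t * z ^ 2),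
    fun z hz => ?_, ?_, ?_, 1 + |s| + |t|, by positivity, fun z hz => ?_⟩
  · refine hasSum_mul_quadratic (c := fun n => (cofactorCoeff w s t n : ℂ)) (a := fun n => (a n : ℂ))
      (summable_mul_pow_of_abs_le_one hc hz).hasSum (by simp [a0, hc0]) ?_ fun n => ?_
    · rw [hc0]
      exact_mod_cast congrArg (fun x : ℝ => (x : ℂ)) (a1.trans (by ring :
        _ = cofactorCoeff w s t 1 - s * 1))
    · exact_mod_cast congrArg (fun x : ℝ => (x : ℂ)) (a2 n)
  · simp only [hP]
    simp
  · refine mul_ne_zero (tsum_mul_pow_ne_zero hc0 (summable_mul_pow_of_abs_le_one hc hβ)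
      (cofactorCoeff_mul_nonneg w (by simp [w]) s t)) ?_
    rw [hP]
    exact div_ne_zero (mul_ne_zero (sub_ne_zero.2 h1) (sub_ne_zero.2 h2)) (mul_ne_zero h0 h0')
  · have hQ : ‖1 - s * z + t * z ^ 2‖ ≤ 1 + |s| + |t| := by
      refine (norm_add_le _ _).trans (add_le_add ((norm_sub_le _ _).trans ?_) ?_)
      · rw [norm_one, norm_mul, Complex.norm_real, Real.norm_eq_abs]
        gcongr
        exact mul_le_of_le_one_right (abs_nonneg s) hz.le
      · rw [norm_mul, norm_pow, Complex.norm_real, Real.norm_eq_abs]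
        exact mul_le_of_le_one_right (abs_nonneg t) (pow_le_one₀ (norm_nonneg z) hz.le)
    rw [norm_mul, div_eq_inv_mul]
    exact mul_le_mul (norm_tsum_mul_pow_le hc hz) hQ (norm_nonneg _)
      (inv_nonneg.2 (by linarith))
end

section
/- Let α ∈ ℂ with 0 < |α| < 1 and let β ∈ ℂ be such that if α is real then β is real. Then there exists a bounded sequence of integers (a_k)_{k≥0} such that the power series g(z) = Σ_{k≥0} a_k z^k converges on the open unit ball (so g ∈ ℤ{z}) and g(α) = β. -/
/-- The second digit of `u` with respect to the pair `1, α`. -/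
noncomputable def imDigit (α u : ℂ) : ℤ := round (u.im / α.im)

/-- The first digit of `u` with respect to the pair `1, α`. -/
noncomputable def reDigit (α u : ℂ) : ℤ := round (u - imDigit α u * α).re

/-- The successive remainders of the expansion of `β` in powers of `α` with digits `reDigit`. -/
noncomputable def remainder (α β : ℂ) : ℕ → ℂ
  | 0 => β
  | n + 1 => (remainder α β n - reDigit α (remainder α β n)) / α

lemma norm_sub_digits_le_one {α u : ℂ} (hα : ‖α‖ < 1) (hu : α.im = 0 → u.im = 0) :
    ‖u - reDigit α u - imDigit α u * α‖ ≤ 1 := by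
  set r := u - reDigit α u - imDigit α u * α with hr
  have hre : |r.re| ≤ 1 / 2 := by
    have h : r.re = (u - imDigit α u * α).re - round (u - imDigit α u * α).re := by
      rw [hr, reDigit]
      simp only [Complex.sub_re, Complex.intCast_re]
      ring
    rw [h]
    exact abs_sub_round _
  have him : |r.im| ≤ 1 / 2 := by
    have h : r.im = u.im - round (u.im / α.im) * α.im := by
      simp [hr, imDigit]
    rw [h]
    by_cases h0 : α.im = 0
    · simp [h0, hu h0]
    · have hfac : u.im - round (u.im / α.im) * α.im
          = (u.im / α.im - round (u.im / α.im)) * α.im := by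
        field_simp
      rw [hfac, abs_mul]
      have := Complex.abs_im_le_norm α
      nlinarith [abs_sub_round (u.im / α.im), abs_nonneg α.im,
        abs_nonneg (u.im / α.im - round (u.im / α.im))]
  linarith [Complex.norm_le_abs_re_add_abs_im r]

lemma remainder_succ_eq {α : ℂ} (h0 : α ≠ 0) (β : ℂ) (n : ℕ) :
    remainder α β (n + 1) = imDigit α (remainder α β n) +
      (remainder α β n - reDigit α (remainder α β n)
        - imDigit α (remainder α β n) * α) / α := by
  rw [remainder]
  field_simp
  ring

lemma remainder_im_eq_zero {α β : ℂ} (hreal : α.im = 0 → β.im = 0) (n : ℕ) (h : α.im = 0) :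
    (remainder α β n).im = 0 := by
  induction n with
  | zero => exact hreal h
  | succ n ih => simp [remainder, Complex.div_im, h, ih]

lemma norm_remainder_digits_div_le {α β : ℂ} (hα : ‖α‖ < 1)
    (hreal : α.im = 0 → β.im = 0) (n : ℕ) :
    ‖(remainder α β n - reDigit α (remainder α β n)
        - imDigit α (remainder α β n) * α) / α‖ ≤ 1 / ‖α‖ := by
  rw [norm_div]
  gcongr
  exact norm_sub_digits_le_one hα (remainder_im_eq_zero hreal n)

lemma abs_remainder_im_le {α β : ℂ} (h0 : α ≠ 0) (hα : ‖α‖ < 1)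
    (hreal : α.im = 0 → β.im = 0) (n : ℕ) :
    |(remainder α β n).im| ≤ ‖β‖ + 1 / ‖α‖ := by
  cases n with
  | zero =>
    have : 0 ≤ 1 / ‖α‖ := by positivity
    exact (Complex.abs_im_le_norm β).trans (by linarith)
  | succ n =>
    rw [remainder_succ_eq h0, Complex.add_im, Complex.intCast_im, zero_add]
    refine (Complex.abs_im_le_norm _).trans ?_
    linarith [norm_remainder_digits_div_le hα hreal n, norm_nonneg β]

lemma abs_round_le (x : ℝ) : |(round x : ℝ)| ≤ |x| + 1 / 2 := by
  have h1 := abs_sub_round x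
  have h2 := abs_sub_abs_le_abs_sub (round x : ℝ) x
  rw [abs_sub_comm] at h2
  linarith

lemma abs_imDigit_remainder_le {α β : ℂ} (h0 : α ≠ 0) (hα : ‖α‖ < 1)
    (hreal : α.im = 0 → β.im = 0) (n : ℕ) :
    |(imDigit α (remainder α β n) : ℝ)| ≤ (‖β‖ + 1 / ‖α‖) / |α.im| + 1 / 2 := by
  refine (abs_round_le _).trans ?_
  rw [abs_div]
  gcongr
  exact abs_remainder_im_le h0 hα hreal n

lemma exists_norm_remainder_le {α β : ℂ} (h0 : α ≠ 0) (hα : ‖α‖ < 1)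
    (hreal : α.im = 0 → β.im = 0) : ∃ C : ℝ, ∀ n, ‖remainder α β n‖ ≤ C := by
  refine ⟨‖β‖ + ((‖β‖ + 1 / ‖α‖) / |α.im| + 1 / 2 + 1 / ‖α‖), fun n => ?_⟩
  cases n with
  | zero =>
    have : 0 ≤ (‖β‖ + 1 / ‖α‖) / |α.im| + 1 / 2 + 1 / ‖α‖ := by positivity
    rw [remainder]
    linarith
  | succ n =>
    rw [remainder_succ_eq h0]
    refine (norm_add_le _ _).trans ?_
    rw [Complex.norm_intCast]
    linarith [abs_imDigit_remainder_le h0 hα hreal n, norm_remainder_digits_div_le hα hreal n,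
      norm_nonneg β]

lemma sum_reDigit_remainder {α : ℂ} (h0 : α ≠ 0) (β : ℂ) (n : ℕ) :
    ∑ k ∈ Finset.range n, (reDigit α (remainder α β k) : ℂ) * α ^ k
      = β - α ^ n * remainder α β n := by
  induction n with
  | zero => simp [remainder]
  | succ n ih =>
    rw [Finset.sum_range_succ, ih, remainder]
    field_simp
    ring

lemma summable_intCast_mul_pow {a : ℕ → ℤ} {B : ℝ} (ha : ∀ k, |(a k : ℝ)| ≤ B) {z : ℂ}
    (hz : ‖z‖ < 1) : Summable fun k => (a k : ℂ) * z ^ k := by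
  refine Summable.of_norm_bounded
    ((summable_geometric_of_lt_one (norm_nonneg z) hz).mul_left B) fun k => ?_
  rw [norm_mul, norm_pow, Complex.norm_intCast]
  gcongr
  exact ha k

theorem exists_bounded_intSeries_hitting_beta (α β : ℂ)
    (h0 : α ≠ 0) (hα : ‖α‖ < 1) (hreal : α.im = 0 → β.im = 0) :
    ∃ a : ℕ → ℤ, (∃ B : ℝ, ∀ k : ℕ, |(a k : ℝ)| ≤ B) ∧
      (∀ z : ℂ, ‖z‖ < 1 → Summable fun k => (a k : ℂ) * z ^ k) ∧
      HasSum (fun k => (a k : ℂ) * α ^ k) β := by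
  obtain ⟨C, hC⟩ := exists_norm_remainder_le h0 hα hreal
  have hB : ∀ k, |(reDigit α (remainder α β k) : ℝ)| ≤ C + C * ‖α‖ := by
    intro k
    have h : (reDigit α (remainder α β k) : ℂ)
        = remainder α β k - remainder α β (k + 1) * α := by
      rw [remainder]
      field_simp
      ring
    rw [← Complex.norm_intCast, h]
    refine (norm_sub_le _ _).trans ?_
    rw [norm_mul]
    gcongr
    exacts [hC k, hC (k + 1)]
  refine ⟨fun k => reDigit α (remainder α β k), ⟨_, hB⟩,
    fun z hz => summable_intCast_mul_pow hB hz, ?_⟩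
  rw [(summable_intCast_mul_pow hB hα).hasSum_iff_tendsto_nat]
  simp_rw [sum_reDigit_remainder h0]
  have hlim : Filter.Tendsto (fun n => α ^ n * remainder α β n) Filter.atTop (nhds 0) := by
    refine squeeze_zero_norm (a := fun n => ‖α‖ ^ n * C) (fun n => ?_) ?_
    · rw [norm_mul, norm_pow]
      gcongr
      exact hC n
    · simpa using (tendsto_pow_atTop_nhds_zero_of_lt_one (norm_nonneg α) hα).mul_const C
  simpa using hlim.const_sub β
end

section
/- Let α be a real number with 0 < α < 1 and let β be a real number. Then there exists a sequence of integers (a_k)_{k≥0} with a_0 = ⌊β⌋ and 0 ≤ a_k ≤ 1/α for all k ≥ 1, such that β = Σ_{k≥0} a_k α^k (the series converging). -/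
/-- The remainders of the greedy base-`1/α` expansion of `β`. -/
noncomputable def expansionRemainder (α β : ℝ) : ℕ → ℝ
  | 0 => β
  | n + 1 => Int.fract (expansionRemainder α β n) / α

theorem sum_floor_expansionRemainder {α : ℝ} (hα : α ≠ 0) (β : ℝ) (n : ℕ) :
    ∑ k ∈ Finset.range n, (⌊expansionRemainder α β k⌋ : ℝ) * α ^ k =
      β - expansionRemainder α β n * α ^ n := by
  induction n with
  | zero => simp [expansionRemainder]
  | succ n ih =>
    rw [Finset.sum_range_succ, ih, expansionRemainder, Int.fract]
    field_simp
    ring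

theorem expansionRemainder_succ_nonneg {α : ℝ} (h0 : 0 < α) (β : ℝ) (n : ℕ) :
    0 ≤ expansionRemainder α β (n + 1) :=
  div_nonneg (Int.fract_nonneg _) h0.le

theorem expansionRemainder_succ_le {α : ℝ} (h0 : 0 < α) (β : ℝ) (n : ℕ) :
    expansionRemainder α β (n + 1) ≤ 1 / α :=
  div_le_div_of_nonneg_right (Int.fract_lt_one _).le h0.le

theorem exists_base_one_div_alpha_expansion (α β : ℝ) (h0 : 0 < α) (h1 : α < 1) :
    ∃ a : ℕ → ℤ, a 0 = ⌊β⌋ ∧ (∀ k : ℕ, 1 ≤ k → 0 ≤ a k ∧ (a k : ℝ) ≤ 1 / α) ∧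
      HasSum (fun k => (a k : ℝ) * α ^ k) β := by
  have digit_bounds (k : ℕ) : 0 ≤ ⌊expansionRemainder α β (k + 1)⌋ ∧
      (⌊expansionRemainder α β (k + 1)⌋ : ℝ) ≤ 1 / α :=
    ⟨Int.floor_nonneg.2 (expansionRemainder_succ_nonneg h0 β k),
      (Int.floor_le _).trans (expansionRemainder_succ_le h0 β k)⟩
  have tendsto_geometric : Filter.Tendsto (fun n : ℕ => 1 / α * α ^ (n + 1)) Filter.atTop
      (nhds 0) := by
    simpa using ((Filter.tendsto_add_atTop_iff_nat 1).2
      (tendsto_pow_atTop_nhds_zero_of_lt_one h0.le h1)).const_mul (1 / α)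
  have tendsto_remainder : Filter.Tendsto (fun n => expansionRemainder α β n * α ^ n)
      Filter.atTop (nhds 0) := by
    rw [← Filter.tendsto_add_atTop_iff_nat 1]
    refine squeeze_zero (fun n => ?_) (fun n => ?_) tendsto_geometric
    · exact mul_nonneg (expansionRemainder_succ_nonneg h0 β n) (by positivity)
    · exact mul_le_mul_of_nonneg_right (expansionRemainder_succ_le h0 β n) (by positivity)
  have summable_digits :
      Summable fun k => (⌊expansionRemainder α β k⌋ : ℝ) * α ^ k := by
    rw [← summable_nat_add_iff 1]
    refine Summable.of_nonneg_of_le (fun n => ?_) (fun n => ?_)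
      (((summable_nat_add_iff 1).2 (summable_geometric_of_lt_one h0.le h1)).mul_left (1 / α))
    · exact mul_nonneg (Int.cast_nonneg (digit_bounds n).1) (by positivity)
    · exact mul_le_mul_of_nonneg_right (digit_bounds n).2 (by positivity)
  refine ⟨fun k => ⌊expansionRemainder α β k⌋, rfl, fun k hk => ?_, ?_⟩
  · obtain ⟨m, rfl⟩ := Nat.exists_eq_add_of_le' hk
    exact digit_bounds m
  · rw [summable_digits.hasSum_iff_tendsto_nat]
    simp_rw [sum_floor_expansionRemainder h0.ne']
    simpa using tendsto_remainder.const_sub β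
end

section
/- Let α ∈ ℂ \ ℝ with |α| < 1, let β ∈ ℂ, and let K > 0 be a constant such that every z ∈ ℂ can be written uniquely as z = x + yα with real x, y satisfying |x|, |y| ≤ K|z|. Then there exist sequences of integers (b_k)_{k≥0} and (c_k)_{k≥0} with |b_0|, |c_0| ≤ K|β| + 1 and |b_k|, |c_k| ≤ 2K|α|^{−2} + 1 for all k ≥ 1, such that Σ_{k≥0} b_k α^{2k} + Σ_{k≥0} c_k α^{2k+1} = β (both series converging). -/
/-- A power series with eventually bounded integer coefficients, evaluated along
an arithmetic progression of powers, converges inside the unit disc. -/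
theorem summable_int_mul_pow_of_bounded {α : ℂ} (hα : ‖α‖ < 1) (a : ℕ → ℤ) (C : ℝ)
    (ha : ∀ k, 1 ≤ k → |(a k : ℝ)| ≤ C) (i : ℕ) :
    Summable fun k => (a k : ℂ) * α ^ (2 * k + i) := by
  rw [← summable_nat_add_iff 1]
  have hsq : ‖α‖ ^ 2 < 1 := pow_lt_one₀ (norm_nonneg _) hα two_ne_zero
  have hgeom : Summable fun k : ℕ => C * ‖α‖ ^ (2 + i) * (‖α‖ ^ 2) ^ k :=
    (summable_geometric_of_lt_one (by positivity) hsq).mul_left _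
  refine Summable.of_norm_bounded hgeom fun k => ?_
  calc ‖(a (k + 1) : ℂ) * α ^ (2 * (k + 1) + i)‖
      = |(a (k + 1) : ℝ)| * ‖α‖ ^ (2 * (k + 1) + i) := by
        rw [norm_mul, norm_pow, Complex.norm_intCast]
    _ ≤ C * ‖α‖ ^ (2 * (k + 1) + i) := by
        gcongr
        exact ha _ (Nat.le_add_left 1 k)
    _ = C * ‖α‖ ^ (2 + i) * (‖α‖ ^ 2) ^ k := by ring

theorem abs_round_le_of_abs_le {x C : ℝ} (hx : |x| ≤ C) : |(round x : ℝ)| ≤ C + 1 := by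
  have h := abs_le.mp (abs_sub_round x)
  have h' := abs_le.mp hx
  rw [abs_le]
  constructor <;> linarith [h.1, h.2, h'.1, h'.2]


theorem exists_two_bounded_int_sequences_summing_to_beta (α β : ℂ)
    (hα : α.im ≠ 0) (hα1 : ‖α‖ < 1) (K : ℝ) (hK : 0 < K)
    (hrep : ∀ z : ℂ, ∃ x y : ℝ,
      z = (x : ℂ) + (y : ℂ) * α ∧ |x| ≤ K * ‖z‖ ∧ |y| ≤ K * ‖z‖ ∧
      ∀ x' y' : ℝ, z = (x' : ℂ) + (y' : ℂ) * α → x' = x ∧ y' = y) :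
    ∃ b c : ℕ → ℤ,
      |(b 0 : ℝ)| ≤ K * ‖β‖ + 1 ∧ |(c 0 : ℝ)| ≤ K * ‖β‖ + 1 ∧
      (∀ k : ℕ, 1 ≤ k →
        |(b k : ℝ)| ≤ 2 * K / ‖α‖ ^ 2 + 1 ∧ |(c k : ℝ)| ≤ 2 * K / ‖α‖ ^ 2 + 1) ∧
      ∃ s t : ℂ, HasSum (fun k => (b k : ℂ) * α ^ (2 * k)) s ∧
        HasSum (fun k => (c k : ℂ) * α ^ (2 * k + 1)) t ∧ s + t = β := by
  have hα0 : α ≠ 0 := fun h => hα (by simp [h])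
  choose x y hxy hx hy _ using hrep
  let step : ℂ → ℂ := fun z => (z - round (x z) - round (y z) * α) / α ^ 2
  let r : ℕ → ℂ := fun n => step^[n] β
  have hr_succ (n : ℕ) : r (n + 1) = step (r n) := Function.iterate_succ_apply' step n β
  have hstep (z : ℂ) : ‖step z‖ ≤ 2 / ‖α‖ ^ 2 := by
    have hz : z - round (x z) - round (y z) * α
        = ((x z - round (x z) : ℝ) : ℂ) + ((y z - round (y z) : ℝ) : ℂ) * α := by
      push_cast
      linear_combination hxy z
    have hnum : ‖z - round (x z) - round (y z) * α‖ ≤ 2 := by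
      rw [hz]
      refine (norm_add_le _ _).trans ?_
      rw [norm_mul, Complex.norm_real, Complex.norm_real, Real.norm_eq_abs, Real.norm_eq_abs]
      nlinarith [abs_sub_round (x z), abs_sub_round (y z), norm_nonneg α,
        abs_nonneg (y z - round (y z))]
    simp only [step, norm_div, norm_pow]
    gcongr
  have hr (k : ℕ) (hk : 1 ≤ k) : K * ‖r k‖ ≤ 2 * K / ‖α‖ ^ 2 := by
    obtain ⟨n, rfl⟩ := Nat.exists_eq_add_of_le' hk
    rw [hr_succ]
    calc K * ‖step (r n)‖ ≤ K * (2 / ‖α‖ ^ 2) := by gcongr; exact hstep _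
      _ = 2 * K / ‖α‖ ^ 2 := by ring
  let b : ℕ → ℤ := fun k => round (x (r k))
  let c : ℕ → ℤ := fun k => round (y (r k))
  have hb (k : ℕ) (hk : 1 ≤ k) : |(b k : ℝ)| ≤ 2 * K / ‖α‖ ^ 2 + 1 :=
    abs_round_le_of_abs_le ((hx _).trans (hr k hk))
  have hc (k : ℕ) (hk : 1 ≤ k) : |(c k : ℝ)| ≤ 2 * K / ‖α‖ ^ 2 + 1 :=
    abs_round_le_of_abs_le ((hy _).trans (hr k hk))
  have hsb := (summable_int_mul_pow_of_bounded hα1 b _ hb 0).hasSum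
  have hsc := (summable_int_mul_pow_of_bounded hα1 c _ hc 1).hasSum
  refine ⟨b, c, abs_round_le_of_abs_le (hx β), abs_round_le_of_abs_le (hy β),
    fun k hk => ⟨hb k hk, hc k hk⟩, _, _, hsb, hsc, ?_⟩
  have hpartial (n : ℕ) : ∑ k ∈ Finset.range n,
      ((b k : ℂ) * α ^ (2 * k + 0) + (c k : ℂ) * α ^ (2 * k + 1)) = β - r n * α ^ (2 * n) := by
    induction n with
    | zero => simp [r]
    | succ n ih =>
      have hrn : r (n + 1) * α ^ 2 = r n - b n - c n * α := by
        rw [hr_succ]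
        exact div_mul_cancel₀ _ (pow_ne_zero 2 hα0)
      rw [Finset.sum_range_succ, ih]
      linear_combination α ^ (2 * n) * hrn
  have hrem : Filter.Tendsto (fun n => r n * α ^ (2 * n)) Filter.atTop (nhds 0) := by
    rw [← Filter.tendsto_add_atTop_iff_nat 1]
    have hsq : ‖α ^ 2‖ < 1 := by
      rw [norm_pow]
      exact pow_lt_one₀ (norm_nonneg _) hα1 two_ne_zero
    have hpow : Filter.Tendsto (fun n : ℕ => α ^ (2 * (n + 1))) Filter.atTop (nhds 0) := by
      simpa only [pow_mul, Function.comp_def] using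
        (tendsto_pow_atTop_nhds_zero_of_norm_lt_one hsq).comp (Filter.tendsto_add_atTop_nat 1)
    have hbound : Filter.Tendsto (fun n : ℕ => 2 / ‖α‖ ^ 2 * ‖α ^ (2 * (n + 1))‖)
        Filter.atTop (nhds 0) := by
      simpa using hpow.norm.const_mul (2 / ‖α‖ ^ 2)
    refine squeeze_zero_norm (fun n => ?_) hbound
    rw [norm_mul, hr_succ]
    gcongr
    exact hstep _
  have hlim := (hsb.add hsc).tendsto_sum_nat
  simp only [hpartial] at hlim
  refine tendsto_nhds_unique hlim ?_
  simpa using hrem.const_sub β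
end

section
/- Let α be an algebraic number with |α| < 1. Then there exists a function f ∈ ℤ{z} such that: (i) for every algebraic number z with |z| < 1, f(z) lies in ℚ(i) (i.e., f(z) = p + qi with p, q rational); (ii) for every algebraic number z with |z| < 1, f(z) = 0 if and only if z = α or z equals the complex conjugate of α; and (iii) there exists a constant C > 0 such that |f(z)| ≤ C·exp(2/(1 − |z|)²) for all z with |z| < 1. -/
open ComplexConjugate

open Polynomial

/-- The nonzero elements of `ℚ(i)`. -/
def nonzeroGaussianRationals : Set ℂ :=
  {x | x ≠ 0 ∧ ∃ p q : ℚ, x = (p : ℂ) + (q : ℂ) * Complex.I}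

/-- The real polynomial `(1 - X / w) (1 - X / conj w)`. -/
noncomputable def conjQuadratic (w : ℂ) : ℝ[X] :=
  1 - C (2 * w.re / Complex.normSq w) * X + C (1 / Complex.normSq w) * X ^ 2

theorem conjQuadratic_coeff_zero (w : ℂ) : (conjQuadratic w).coeff 0 = 1 := by
  simp [conjQuadratic]

theorem aeval_conjQuadratic {w : ℂ} (hw : w ≠ 0) (z : ℂ) :
    aeval z (conjQuadratic w) = (1 - z / w) * (1 - z / conj w) := by
  have hw' : conj w ≠ 0 := by simpa using hw
  have h1 : ((Complex.normSq w : ℝ) : ℂ) = w * conj w := (Complex.mul_conj w).symm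
  have h2 : ((2 * w.re : ℝ) : ℂ) = w + conj w := (Complex.add_conj w).symm
  simp only [conjQuadratic, map_add, map_sub, map_one, map_mul, aeval_C, aeval_X, map_pow,
    Complex.coe_algebraMap, Complex.ofReal_div, h1, h2, Complex.ofReal_one]
  field_simp
  ring

theorem aeval_conjQuadratic_eq_zero_iff {w : ℂ} (hw : w ≠ 0) (z : ℂ) :
    aeval z (conjQuadratic w) = 0 ↔ z = w ∨ z = conj w := by
  have hw' : conj w ≠ 0 := by simpa using hw
  rw [aeval_conjQuadratic hw, mul_eq_zero, sub_eq_zero, sub_eq_zero, eq_comm, div_eq_one_iff_eq hw,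
    eq_comm (a := (1 : ℂ)), div_eq_one_iff_eq hw']

theorem aeval_conj_eq_conj (F : ℝ[X]) (z : ℂ) : aeval (conj z) F = conj (aeval z F) := by
  have := aeval_algHom_apply Complex.conjAe.toAlgHom z F
  simpa using this

theorem conj_mem_nonzeroGaussianRationals {x : ℂ} (hx : x ∈ nonzeroGaussianRationals) :
    conj x ∈ nonzeroGaussianRationals := by
  obtain ⟨h0, p, q, rfl⟩ := hx
  refine ⟨by simpa only [ne_eq, map_eq_zero] using h0, p, -q, ?_⟩
  simp

theorem exists_nonzeroGaussianRational_near (A : ℂ) {ε : ℝ} (hε : 0 < ε) :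
    ∃ x ∈ nonzeroGaussianRationals, ‖x - A‖ < ε ∧ (A.im = 0 → x.im = 0) := by
  have key : ∃ p : ℚ, p ≠ 0 ∧ |(p : ℝ) - A.re| < ε / 2 := by
    obtain ⟨p, hp1, hp2⟩ := exists_rat_btwn (show A.re < A.re + ε / 2 by linarith)
    by_cases hp : p = 0
    · subst hp
      obtain ⟨p', hp1', hp2'⟩ := exists_rat_btwn hp1
      refine ⟨p', ?_, ?_⟩
      · rintro rfl
        exact lt_irrefl _ hp2'
      · rw [abs_lt]
        constructor <;> linarith [hp2'.trans hp2]
    · refine ⟨p, hp, ?_⟩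
      rw [abs_lt]
      constructor <;> linarith
  obtain ⟨p, hp0, hp⟩ := key
  have key2 : ∃ q : ℚ, |(q : ℝ) - A.im| < ε / 2 ∧ (A.im = 0 → q = 0) := by
    by_cases h : A.im = 0
    · exact ⟨0, by simpa [h] using hε, fun _ => rfl⟩
    · obtain ⟨q, hq1, hq2⟩ := exists_rat_btwn (show A.im < A.im + ε / 2 by linarith)
      refine ⟨q, ?_, fun h' => absurd h' h⟩
      rw [abs_lt]
      constructor <;> linarith
  obtain ⟨q, hq, hq0⟩ := key2
  refine ⟨(p : ℂ) + (q : ℂ) * Complex.I, ⟨?_, p, q, rfl⟩, ?_, ?_⟩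
  · intro h
    apply hp0
    have := congrArg Complex.re h
    simpa using this
  · refine (Complex.norm_le_abs_re_add_abs_im _).trans_lt ?_
    simp only [Complex.sub_re, Complex.add_re, Complex.ratCast_re, Complex.mul_re, Complex.I_re,
      mul_zero, Complex.ratCast_im, Complex.I_im, mul_one, sub_zero, add_zero, Complex.sub_im,
      Complex.add_im, Complex.mul_im, zero_add]
    linarith
  · intro h
    simp [hq0 h]

theorem exists_real_add_real_mul_eq (w : ℂ) : ∃ K : ℝ, 0 < K ∧ ∀ Q : ℂ, (w.im = 0 → Q.im = 0) →
    ∃ u v : ℝ, (u : ℂ) + v * w = Q ∧ |u| ≤ K * ‖Q‖ ∧ |v| ≤ K * ‖Q‖ := by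
  by_cases hw : w.im = 0
  · refine ⟨1, one_pos, fun Q hQ => ⟨Q.re, 0, ?_, ?_, ?_⟩⟩
    · apply Complex.ext <;> simp [hQ hw]
    · simpa using Complex.abs_re_le_norm Q
    · simp
  · have hw' : 0 < |w.im| := abs_pos.mpr hw
    refine ⟨1 + (1 + |w.re|) / |w.im|, by positivity, fun Q _ =>
      ⟨Q.re - Q.im / w.im * w.re, Q.im / w.im, ?_, ?_, ?_⟩⟩
    · apply Complex.ext
      · simp
      · simp [hw]
    · have h1 := Complex.abs_re_le_norm Q
      have h2 := Complex.abs_im_le_norm Q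
      calc |Q.re - Q.im / w.im * w.re| ≤ |Q.re| + |Q.im / w.im * w.re| := abs_sub _ _
        _ = |Q.re| + |Q.im| * (|w.re| / |w.im|) := by rw [abs_mul, abs_div]; ring
        _ ≤ ‖Q‖ + ‖Q‖ * ((1 + |w.re|) / |w.im|) := by
          gcongr
          linarith
        _ = _ := by ring
    · have h2 := Complex.abs_im_le_norm Q
      have h3 : 0 ≤ |w.re| / |w.im| := by positivity
      calc |Q.im / w.im| = |Q.im| * (1 / |w.im|) := by rw [abs_div]; ring
        _ ≤ ‖Q‖ * (1 / |w.im|) := by gcongr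
        _ ≤ ‖Q‖ * (1 + (1 + |w.re|) / |w.im|) := by
          gcongr
          rw [add_div]
          linarith
        _ = _ := by ring

theorem exists_correction (F P : ℝ[X]) (n : ℕ) {w : ℂ} (hw : w ≠ 0) :
    ∃ u v : ℝ, |u| < 1 ∧ |v| < 1 ∧ (aeval w P ≠ 0 →
      aeval w F + w ^ n * (aeval w P * (u + v * w)) ∈ nonzeroGaussianRationals) := by
  by_cases hP : aeval w P = 0
  · exact ⟨0, 0, by simp, by simp, fun h => absurd hP h⟩
  obtain ⟨K, hK, hQ⟩ := exists_real_add_real_mul_eq w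
  set B : ℂ := w ^ n * aeval w P with hB
  have hB0 : B ≠ 0 := mul_ne_zero (pow_ne_zero _ hw) hP
  have hBn : 0 < ‖B‖ := norm_pos_iff.mpr hB0
  obtain ⟨x, hx, hxA, hxr⟩ := exists_nonzeroGaussianRational_near (aeval w F)
    (show 0 < ‖B‖ / K by positivity)
  have hreal : w.im = 0 → ((x - aeval w F) / B).im = 0 := by
    intro h
    have hc : conj w = w := Complex.conj_eq_iff_im.mpr h
    have h1 : ∀ G : ℝ[X], conj (aeval w G) = aeval w G := fun G => by
      rw [← aeval_conj_eq_conj, hc]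
    have h2 : conj x = x := Complex.conj_eq_iff_im.mpr (hxr (Complex.conj_eq_iff_im.mp (h1 F)))
    rw [← Complex.conj_eq_iff_im]
    simp [hB, h1, h2, hc]
  obtain ⟨u, v, huv, hu, hv⟩ := hQ _ hreal
  have hlt : K * ‖(x - aeval w F) / B‖ < 1 := by
    rw [norm_div, ← mul_div_assoc, div_lt_one hBn]
    rwa [lt_div_iff₀ hK, mul_comm] at hxA
  refine ⟨u, v, hu.trans_lt hlt, hv.trans_lt hlt, fun _ => ?_⟩
  rw [← mul_assoc, huv, ← hB, mul_div_cancel₀ _ hB0]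
  simpa using hx

theorem exists_next_approximant (F P : ℝ[X]) (hP : P.coeff 0 = 1) (n : ℕ) {w : ℂ} (hw : w ≠ 0) :
    ∃ u v c : ℝ, |u| < 1 ∧ |v| < 1 ∧ 1 ≤ c ∧ c ≤ 2 ∧ ∃ F' : ℝ[X],
      F' = F + X ^ n * (P * (C u + C v * X) + C c * (P * conjQuadratic w)) ∧
      F'.coeff n = F.coeff n + u + c ∧ (∃ m : ℤ, F'.coeff n = m) ∧
      ∀ z : ℂ, aeval z (conjQuadratic w) = 0 → aeval z P ≠ 0 →
        aeval z F' ∈ nonzeroGaussianRationals := by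
  obtain ⟨u, v, hu, hv, huv⟩ := exists_correction F P n hw
  set x := F.coeff n + u with hx
  have hc1 := Int.le_ceil x
  have hc2 := Int.ceil_lt_add_one x
  set c : ℝ := ⌈x⌉ + 1 - x with hc
  set F' := F + X ^ n * (P * (C u + C v * X) + C c * (P * conjQuadratic w)) with hF'
  have hcoeff : F'.coeff n = F.coeff n + u + c := by
    rw [hF', coeff_add, coeff_X_pow_mul', if_pos le_rfl, Nat.sub_self]
    simp [mul_coeff_zero, hP, conjQuadratic_coeff_zero]
    ring
  refine ⟨u, v, c, hu, hv, by linarith, by linarith, F', rfl, hcoeff, ⟨⌈x⌉ + 1, ?_⟩, ?_⟩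
  · rw [hcoeff, hc]
    push_cast
    ring
  · have hmain : aeval w P ≠ 0 → aeval w F' ∈ nonzeroGaussianRationals := by
      intro h
      have hR : aeval w (conjQuadratic w) = 0 :=
        (aeval_conjQuadratic_eq_zero_iff hw w).mpr (Or.inl rfl)
      have := huv h
      simpa [hF', hR] using this
    intro z hz hPz
    rcases (aeval_conjQuadratic_eq_zero_iff hw z).mp hz with rfl | rfl
    · exact hmain hPz
    · rw [aeval_conj_eq_conj] at hPz ⊢
      exact conj_mem_nonzeroGaussianRationals (hmain fun h => hPz (by simp [h]))

/-- A slowly growing surjection `ℕ → ℕ`, adapted to a growth function `G`. -/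
theorem exists_slow_monotone_surjection (G : ℕ → ℝ) : ∃ k : ℕ → ℕ, Monotone k ∧
    (∀ j, ∃ n, k n = j ∧ k (n + 1) = j + 1) ∧ ∃ G₀ : ℝ, 0 ≤ G₀ ∧ ∀ n, G (k n) ≤ n + G₀ := by
  classical
  let k : ℕ → ℕ := fun n =>
    Nat.rec 0 (fun n j => if G (j + 1) ≤ (n : ℝ) then j + 1 else j) n
  have hk0 : k 0 = 0 := rfl
  have hks : ∀ n, k (n + 1) = if G (k n + 1) ≤ (n : ℝ) then k n + 1 else k n := fun n => rfl
  have hjump : ∀ n, ∃ m, n ≤ m ∧ k m = k n ∧ k (m + 1) = k n + 1 := by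
    intro n
    by_contra! hcon
    have hconst : ∀ d, k (n + d) = k n := by
      intro d
      induction d with
      | zero => rfl
      | succ d ih =>
        have h1 := hcon (n + d) (Nat.le_add_right _ _) ih
        have h2 := hks (n + d)
        rw [ih] at h2
        split_ifs at h2
        · exact absurd h2 h1
        · exact h2
    obtain ⟨N, hN⟩ := exists_nat_ge (G (k n + 1))
    refine hcon (n + N) (Nat.le_add_right _ _) (hconst N) ?_
    rw [hks, hconst, if_pos]
    push_cast
    linarith [(Nat.cast_nonneg n : (0 : ℝ) ≤ n)]
  have hreach : ∀ j, ∃ n, k n = j := by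
    intro j
    induction j with
    | zero => exact ⟨0, hk0⟩
    | succ j ih =>
      obtain ⟨n, hn⟩ := ih
      obtain ⟨m, -, -, hm⟩ := hjump n
      exact ⟨m + 1, by rw [hm, hn]⟩
  refine ⟨k, monotone_nat_of_le_succ fun n => ?_, fun j => ?_, |G 0|, abs_nonneg _, fun n => ?_⟩
  · rw [hks]
    split_ifs <;> omega
  · obtain ⟨n, rfl⟩ := hreach j
    obtain ⟨m, -, h1, h2⟩ := hjump n
    exact ⟨m, h1, h2⟩
  · induction n with
    | zero => simpa [hk0] using le_abs_self (G 0)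
    | succ n ih =>
      rw [hks]
      push_cast
      split_ifs with h
      · linarith [abs_nonneg (G 0)]
      · linarith

theorem exists_coeff_bound (P : ℝ[X]) : ∃ A : ℝ, ∀ m, |P.coeff m| ≤ A := by
  refine ⟨∑ i ∈ P.support, |P.coeff i|, fun m => ?_⟩
  by_cases hm : m ∈ P.support
  · exact Finset.single_le_sum (f := fun i => |P.coeff i|) (fun i _ => abs_nonneg _) hm
  · rw [notMem_support_iff.mp hm, abs_zero]
    positivity

theorem abs_coeff_X_pow_mul_le {P R : ℝ[X]} {A B u v c : ℝ} (hP : ∀ m, |P.coeff m| ≤ A)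
    (hR : ∀ m, |R.coeff m| ≤ B) (hu : |u| ≤ 1) (hv : |v| ≤ 1) (hc : |c| ≤ 2) (n m : ℕ) :
    |(X ^ n * (P * (C u + C v * X) + C c * R)).coeff m| ≤ 2 * A + 2 * B := by
  have hA : 0 ≤ A := (abs_nonneg _).trans (hP 0)
  have hB : 0 ≤ B := (abs_nonneg _).trans (hR 0)
  have hshift : ∀ i, |(P * X).coeff i| ≤ A := by
    intro i
    cases i with
    | zero => simpa using hA
    | succ i => simpa using hP i
  rw [coeff_X_pow_mul']
  split_ifs
  · have : (P * (C u + C v * X) + C c * R).coeff (m - n) =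
        u * P.coeff (m - n) + v * (P * X).coeff (m - n) + c * R.coeff (m - n) := by
      have : P * (C u + C v * X) + C c * R = C u * P + C v * (P * X) + C c * R := by ring
      rw [this, coeff_add, coeff_add, coeff_C_mul, coeff_C_mul, coeff_C_mul]
    rw [this]
    calc _ ≤ |u| * |P.coeff (m - n)| + |v| * |(P * X).coeff (m - n)| +
          |c| * |R.coeff (m - n)| := by
          rw [← abs_mul, ← abs_mul, ← abs_mul]
          exact abs_add_three _ _ _
      _ ≤ 1 * A + 1 * A + 2 * B := by
          gcongr
          exacts [hP _, hshift _, hR _]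
      _ = _ := by ring
  · simp only [abs_zero]
    positivity

theorem hasSum_aeval (F : ℝ[X]) (z : ℂ) :
    HasSum (fun m => (F.coeff m : ℂ) * z ^ m) (aeval z F) := by
  rw [aeval_eq_sum_range]
  have : ∀ b ∉ Finset.range (F.natDegree + 1), (F.coeff b : ℂ) * z ^ b = 0 := by
    intro b hb
    rw [coeff_eq_zero_of_natDegree_lt (by simpa using hb)]
    simp
  simpa [Algebra.smul_def] using hasSum_sum_of_ne_finset_zero this

theorem summable_sq_mul_geometric {r : ℝ} (h0 : 0 ≤ r) (h1 : r < 1) (K : ℝ) (hK : 0 ≤ K) :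
    Summable (fun m : ℕ => K * ((m : ℝ) + 1) ^ 2 * r ^ m) ∧
      ∑' m : ℕ, K * ((m : ℝ) + 1) ^ 2 * r ^ m ≤ 12 * K * Real.exp (2 / (1 - r) ^ 2) := by
  have hr : ‖r‖ < 1 := by rwa [Real.norm_of_nonneg h0]
  have hs := (hasSum_choose_mul_geometric_of_norm_lt_one 2 hr).mul_left (2 * K)
  have hle : ∀ m : ℕ, K * ((m : ℝ) + 1) ^ 2 * r ^ m ≤
      2 * K * (((m + 2).choose 2 : ℕ) * r ^ m) := by
    intro m
    rw [Nat.cast_choose_two, ← mul_assoc, mul_comm 2 K, mul_assoc K 2]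
    gcongr
    push_cast
    nlinarith [(Nat.cast_nonneg m : (0 : ℝ) ≤ m)]
  have hsum := hs.summable.of_nonneg_of_le (fun m => by positivity) hle
  refine ⟨hsum, (hsum.tsum_le_tsum hle hs.summable).trans ?_⟩
  rw [hs.tsum_eq]
  have hpos : 0 < 1 - r := by linarith
  set x := 1 / (1 - r) with hx
  have hx1 : 1 ≤ x := by
    rw [hx, le_div_iff₀ hpos]
    linarith
  have e1 : 2 / (1 - r) ^ 2 = 2 * x ^ 2 := by rw [hx]; field_simp
  have e2 : 1 / (1 - r) ^ (2 + 1) = x ^ 3 := by rw [hx]; field_simp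
  rw [e1, e2]
  have h3 := Real.pow_div_factorial_le_exp x (by linarith) 3
  have h4 : Real.exp x ≤ Real.exp (2 * x ^ 2) := Real.exp_le_exp.mpr (by nlinarith)
  have h5 : ((Nat.factorial 3 : ℕ) : ℝ) = 6 := by norm_num [Nat.factorial]
  rw [h5] at h3
  have h6 : x ^ 3 ≤ 6 * Real.exp (2 * x ^ 2) := by linarith
  calc 2 * K * x ^ 3 ≤ 2 * K * (6 * Real.exp (2 * x ^ 2)) := by gcongr
    _ = _ := by ring

/-- If the coefficients of the real polynomials `F n` stabilise at integers and the increments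
`F (n + 1) - F n` have controlled coefficients and order of vanishing, then the limit is an integer
power series on the unit disc which is the pointwise limit of the `F n`. -/
theorem exists_intSeries_of_approximants (F : ℕ → ℝ[X]) (hF0 : F 0 = 0) {G₀ : ℝ} (hG₀ : 0 ≤ G₀)
    (hstab : ∀ n m, m < n → (F (n + 1)).coeff m = (F n).coeff m)
    (hbound : ∀ n m, |(F (n + 1)).coeff m - (F n).coeff m| ≤ n + G₀)
    (hint : ∀ m, ∃ a : ℤ, (F (m + 1)).coeff m = a) :
    ∃ (a : ℕ → ℤ) (f : ℂ → ℂ), IsIntSeries a f ∧ ((a 0 : ℝ) = (F 1).coeff 0) ∧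
      (∀ z : ℂ, ‖z‖ < 1 →
        Filter.Tendsto (fun N => aeval z (F N)) Filter.atTop (nhds (f z))) ∧
      ∃ K : ℝ, 0 < K ∧ ∀ z : ℂ, ‖z‖ < 1 → ‖f z‖ ≤ K * Real.exp (2 / (1 - ‖z‖) ^ 2) := by
  choose a ha using hint
  have hconst : ∀ m d, (F (m + 1 + d)).coeff m = a m := by
    intro m d
    induction d with
    | zero => exact ha m
    | succ d ih => rw [← ih, ← add_assoc, hstab _ _ (by omega)]
  have hsmall : ∀ m N, N ≤ m + 1 → |(F N).coeff m| ≤ N * (m + G₀) := by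
    intro m N
    induction N with
    | zero => simp [hF0]
    | succ N ih =>
      intro hN
      have h1 := ih (by omega)
      have h2 := hbound N m
      have h3 : (N : ℝ) ≤ m := by exact_mod_cast (by omega : N ≤ m)
      have h4 := abs_sub_abs_le_abs_sub ((F (N + 1)).coeff m) ((F N).coeff m)
      push_cast
      linarith
  set K : ℝ := 1 + G₀ with hK
  have hall : ∀ m N, |(F N).coeff m| ≤ K * ((m : ℝ) + 1) ^ 2 := by
    intro m N
    have aux : ∀ N, N ≤ m + 1 → |(F N).coeff m| ≤ K * ((m : ℝ) + 1) ^ 2 := by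
      intro N hN
      have hN' : (N : ℝ) ≤ m + 1 := by exact_mod_cast hN
      have hm : (0 : ℝ) ≤ m := Nat.cast_nonneg m
      calc _ ≤ N * (m + G₀) := hsmall m N hN
        _ ≤ (m + 1) * (m + G₀) := by gcongr
        _ ≤ (m + 1) * (K * (m + 1)) := by
          gcongr
          rw [hK]
          nlinarith
        _ = _ := by ring
    rcases le_total N (m + 1) with h | h
    · exact aux N h
    · obtain ⟨d, rfl⟩ := Nat.exists_eq_add_of_le h
      rw [hconst, ← ha]
      exact aux _ le_rfl
  have hKpos : 0 < K := by linarith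
  have hterm : ∀ (z : ℂ) m N,
      ‖((F N).coeff m : ℂ) * z ^ m‖ ≤ K * ((m : ℝ) + 1) ^ 2 * ‖z‖ ^ m := by
    intro z m N
    rw [norm_mul, norm_pow, Complex.norm_real, Real.norm_eq_abs]
    gcongr
    exact hall m N
  have hterma : ∀ (z : ℂ) m, ‖(a m : ℂ) * z ^ m‖ ≤ K * ((m : ℝ) + 1) ^ 2 * ‖z‖ ^ m := by
    intro z m
    have := hterm z m (m + 1)
    rwa [ha, Complex.ofReal_intCast] at this
  refine ⟨a, fun z => ∑' m, (a m : ℂ) * z ^ m, fun z hz => ?_, (ha 0).symm, fun z hz => ?_,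
    12 * K, by positivity, fun z hz => ?_⟩
  · exact (Summable.of_norm_bounded
      (summable_sq_mul_geometric (norm_nonneg z) hz K hKpos.le).1 (hterma z)).hasSum
  · have h : ∀ N, aeval z (F N) = ∑' m, ((F N).coeff m : ℂ) * z ^ m := fun N =>
      (hasSum_aeval (F N) z).tsum_eq.symm
    simp_rw [h]
    refine tendsto_tsum_of_dominated_convergence
      (summable_sq_mul_geometric (norm_nonneg z) hz K hKpos.le).1 (fun m => ?_)
      (Filter.Eventually.of_forall fun N m => hterm z m N)
    refine tendsto_const_nhds.congr' ?_
    filter_upwards [Filter.eventually_ge_atTop (m + 1)] with N hN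
    obtain ⟨d, rfl⟩ := Nat.exists_eq_add_of_le hN
    rw [hconst, Complex.ofReal_intCast]
  · have hs := summable_sq_mul_geometric (norm_nonneg z) hz K hKpos.le
    exact (tsum_of_norm_bounded hs.1.hasSum (hterma z)).trans hs.2

theorem exists_enumeration_nonzero_algebraic : ∃ w : ℕ → ℂ, (∀ n, w n ≠ 0) ∧
    ∀ z : ℂ, IsAlgebraic ℚ z → z ≠ 0 → ∃ n, w n = z := by
  have hc : {z : ℂ | IsAlgebraic ℚ z ∧ z ≠ 0}.Countable :=
    (Algebraic.countable ℚ ℂ).mono fun z hz => hz.1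
  obtain ⟨w, hw⟩ := hc.exists_eq_range ⟨1, isAlgebraic_one, one_ne_zero⟩
  refine ⟨w, fun n => ?_, fun z h1 h2 => ?_⟩
  · have : w n ∈ {z : ℂ | IsAlgebraic ℚ z ∧ z ≠ 0} := hw ▸ Set.mem_range_self n
    exact this.2
  · have : z ∈ Set.range w := hw ▸ (show z ∈ {z : ℂ | IsAlgebraic ℚ z ∧ z ≠ 0} from ⟨h1, h2⟩)
    exact this

theorem exists_intSeries_of_polynomial (P₀ : ℝ[X]) (hP₀ : P₀.coeff 0 = 1) (s : ℕ) :
    ∃ (a : ℕ → ℤ) (f : ℂ → ℂ), IsIntSeries a f ∧ (a 0 = 0 ↔ s ≠ 0) ∧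
      (∀ z : ℂ, ‖z‖ < 1 → aeval z P₀ = 0 → f z = 0) ∧
      (∀ z : ℂ, IsAlgebraic ℚ z → ‖z‖ < 1 → z ≠ 0 → aeval z P₀ ≠ 0 →
        f z ∈ nonzeroGaussianRationals) ∧
      ∃ K : ℝ, 0 < K ∧ ∀ z : ℂ, ‖z‖ < 1 → ‖f z‖ ≤ K * Real.exp (2 / (1 - ‖z‖) ^ 2) := by
  obtain ⟨w, hw0, hw⟩ := exists_enumeration_nonzero_algebraic
  let P : ℕ → ℝ[X] := fun k => P₀ * ∏ j ∈ Finset.range k, conjQuadratic (w j)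
  have hPsucc : ∀ k, P (k + 1) = P k * conjQuadratic (w k) := fun k => by
    simp only [P, Finset.prod_range_succ, mul_assoc]
  have hPzero : P 0 = P₀ := by simp [P]
  have hPcoeff : ∀ k, (P k).coeff 0 = 1 := by
    intro k
    induction k with
    | zero => rw [hPzero, hP₀]
    | succ k ih => rw [hPsucc, mul_coeff_zero, ih, conjQuadratic_coeff_zero, one_mul]
  have hPdvd : ∀ {i j}, i ≤ j → P i ∣ P j := by
    intro i j hij
    induction j, hij using Nat.le_induction with
    | base => exact dvd_rfl
    | succ j _ ih => exact ih.trans ⟨_, hPsucc j⟩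
  choose A hA using fun k => exists_coeff_bound (P k)
  obtain ⟨k, hkmono, hkjump, G₀, hG₀, hkG⟩ :=
    exists_slow_monotone_surjection fun j => 2 * A j + 2 * A (j + 1)
  choose u v c hu hv hc1 hc2 next hnext hcoeff hint hval using fun (n : ℕ) (F : ℝ[X]) =>
    exists_next_approximant F (P (k n)) (hPcoeff (k n)) (n + s) (hw0 (k n))
  let F : ℕ → ℝ[X] := fun n => Nat.rec 0 next n
  have hFs : ∀ n, F (n + 1) = next n (F n) := fun n => rfl
  have hFdiff : ∀ n, F (n + 1) = F n + X ^ (n + s) *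
      (P (k n) * (C (u n (F n)) + C (v n (F n)) * X) + C (c n (F n)) * P (k n + 1)) := fun n => by
    rw [hFs, hnext, hPsucc]
  have hstab : ∀ n m, m < n + s → (F (n + 1)).coeff m = (F n).coeff m := by
    intro n m hm
    rw [hFdiff, coeff_add, coeff_X_pow_mul', if_neg (by omega), add_zero]
  have hbound : ∀ n m, |(F (n + 1)).coeff m - (F n).coeff m| ≤ n + G₀ := by
    intro n m
    rw [hFdiff, coeff_add, add_sub_cancel_left]
    refine (abs_coeff_X_pow_mul_le (hA _) (hA _) (hu _ _).le (hv _ _).le ?_ _ _).trans (hkG n)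
    rw [abs_le]
    exact ⟨by linarith [hc1 n (F n)], hc2 n (F n)⟩
  have hF0 : F 0 = 0 := rfl
  have hlow : ∀ n m, m < s → (F n).coeff m = 0 := by
    intro n m hm
    induction n with
    | zero => simp [hF0]
    | succ n ih => rw [hstab n m (by omega), ih]
  have hinteger : ∀ m, ∃ a : ℤ, (F (m + 1)).coeff m = a := by
    intro m
    rcases lt_or_ge m s with h | h
    · exact ⟨0, by simpa using hlow (m + 1) m h⟩
    · obtain ⟨n, rfl⟩ := Nat.exists_eq_add_of_le' h
      obtain ⟨a, ha⟩ := hint n (F n)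
      refine ⟨a, ?_⟩
      rw [← ha, ← hFs]
      have : ∀ d, (F (n + 1 + d)).coeff (n + s) = (F (n + 1)).coeff (n + s) := by
        intro d
        induction d with
        | zero => rfl
        | succ d ih => rw [← add_assoc, hstab _ _ (by omega), ih]
      rw [← this s, Nat.add_right_comm]
  obtain ⟨a, f, hf, ha0, hlim, hgrowth⟩ := exists_intSeries_of_approximants F hF0 hG₀
    (fun n m h => hstab n m (by omega)) hbound hinteger
  have hFconst : ∀ (z : ℂ) (N : ℕ), aeval z (P (k N)) = 0 → ‖z‖ < 1 →
      f z = aeval z (F N) := by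
    intro z N hz hz1
    have hc : ∀ M, N ≤ M → aeval z (F M) = aeval z (F N) := by
      intro M hM
      induction M, hM using Nat.le_induction with
      | base => rfl
      | succ M hM ih =>
        have h1 : aeval z (P (k M)) = 0 := by
          obtain ⟨Q, hQ⟩ := hPdvd (hkmono hM)
          rw [hQ, map_mul, hz, zero_mul]
        have h2 : aeval z (P (k M + 1)) = 0 := by rw [hPsucc, map_mul, h1, zero_mul]
        rw [hFdiff, ← ih]
        simp [h1, h2]
    refine tendsto_nhds_unique (hlim z hz1) (tendsto_const_nhds.congr' ?_)
    filter_upwards [Filter.eventually_ge_atTop N] with M hM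
    exact (hc M hM).symm
  refine ⟨a, f, hf, ?_, ?_, ?_, hgrowth⟩
  · constructor
    · rintro h rfl
      have h1 := hcoeff 0 (F 0)
      rw [← hFs, add_zero, zero_add, ← ha0, h, hF0, coeff_zero, Int.cast_zero] at h1
      have h2 := hc1 0 0
      have h3 := (abs_lt.mp (hu 0 0)).1
      linarith
    · intro h
      rw [hlow 1 0 (Nat.pos_of_ne_zero h)] at ha0
      exact_mod_cast ha0
  · intro z hz hPz
    have hPk : aeval z (P (k 0)) = 0 := by
      obtain ⟨Q, hQ⟩ := hPdvd (Nat.zero_le (k 0))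
      rw [hQ, map_mul, hPzero, hPz, zero_mul]
    rw [hFconst z 0 hPk hz, hF0, map_zero]
  · intro z hzalg hz hz0 hPz
    have hex : ∃ j, aeval z (P (j + 1)) = 0 := by
      obtain ⟨j, hj⟩ := hw z hzalg hz0
      refine ⟨j, ?_⟩
      rw [hPsucc, map_mul, (aeval_conjQuadratic_eq_zero_iff (hw0 j) z).mpr (Or.inl hj.symm),
        mul_zero]
    classical
    obtain ⟨j, hj, hmin⟩ : ∃ j, aeval z (P (j + 1)) = 0 ∧ aeval z (P j) ≠ 0 := by
      refine ⟨Nat.find hex, Nat.find_spec hex, ?_⟩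
      rcases h : Nat.find hex with _ | i
      · rwa [hPzero]
      · exact Nat.find_min hex (by omega)
    obtain ⟨n, hn, hn'⟩ := hkjump j
    rw [hFconst z (n + 1) (by rwa [hn']) hz, hFs]
    rw [hPsucc, map_mul, mul_eq_zero, or_iff_right hmin] at hj
    exact hval n (F n) z (by rwa [hn]) (by rwa [hn])

theorem exists_intSeries_gaussian_rational_values_vanishing_exactly_at_alpha (α : ℂ)
    (halg : IsAlgebraic ℚ α) (hα : ‖α‖ < 1) :
    ∃ (a : ℕ → ℤ) (f : ℂ → ℂ), IsIntSeries a f ∧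
      (∀ z : ℂ, IsAlgebraic ℚ z → ‖z‖ < 1 →
        ∃ p q : ℚ, f z = (p : ℂ) + (q : ℂ) * Complex.I) ∧
      (∀ z : ℂ, IsAlgebraic ℚ z → ‖z‖ < 1 → (f z = 0 ↔ z = α ∨ z = conj α)) ∧
      ∃ C : ℝ, 0 < C ∧ ∀ z : ℂ, ‖z‖ < 1 →
        ‖f z‖ ≤ C * Real.exp (2 / (1 - ‖z‖) ^ 2) := by
  have haux : ∀ (a : ℕ → ℤ) (f : ℂ → ℂ), IsIntSeries a f → f 0 = a 0 := by
    intro a f hf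
    refine (hf 0 (by simp)).unique ?_
    convert hasSum_single (f := fun n => (a n : ℂ) * 0 ^ n) 0 (fun n hn => by simp [hn]) using 1
    simp
  by_cases h0 : α = 0
  · obtain ⟨a, f, hf, ha, -, hval, hgrowth⟩ :=
      exists_intSeries_of_polynomial 1 coeff_one_zero 1
    have hf0 : f 0 = 0 := by
      rw [haux a f hf, ha.mpr one_ne_zero, Int.cast_zero]
    refine ⟨a, f, hf, fun z hz hz1 => ?_, fun z hz hz1 => ?_, hgrowth⟩
    · by_cases hz0 : z = 0
      · exact ⟨0, 0, by simp [hz0, hf0]⟩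
      · exact (hval z hz hz1 hz0 (by simp)).2
    · subst h0
      simp only [map_zero, or_self]
      refine ⟨fun h => ?_, fun h => h ▸ hf0⟩
      by_contra hz0
      exact (hval z hz hz1 hz0 (by simp)).1 h
  · obtain ⟨a, f, hf, ha, hzero, hval, hgrowth⟩ :=
      exists_intSeries_of_polynomial (conjQuadratic α) (conjQuadratic_coeff_zero α) 0
    have hf0 : f 0 = a 0 := haux a f hf
    have ha0 : a 0 ≠ 0 := fun h => ha.mp h rfl
    refine ⟨a, f, hf, fun z hz hz1 => ?_, fun z hz hz1 => ?_, hgrowth⟩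
    · by_cases hz0 : z = 0
      · exact ⟨a 0, 0, by simp [hz0, hf0]⟩
      · by_cases hP : aeval z (conjQuadratic α) = 0
        · exact ⟨0, 0, by simp [hzero z hz1 hP]⟩
        · exact (hval z hz hz1 hz0 hP).2
    · rw [← aeval_conjQuadratic_eq_zero_iff h0 z]
      refine ⟨fun h => ?_, hzero z hz1⟩
      by_contra hP
      by_cases hz0 : z = 0
      · rw [hz0, hf0] at h
        exact ha0 (by exact_mod_cast h)
      · exact (hval z hz hz1 hz0 hP).1 h
end

section
/- Let g(x) = Σ_{k≥0} a_k x^k be a power series with rational coefficients and positive radius of convergence. If there is a nonzero polynomial f(x,y) ∈ ℂ[x,y] of total degree n such that f(x, g(x)) is identically zero as a power series in x, then there is a nonzero polynomial f̃(x,y) ∈ ℚ[x,y] of total degree at most n such that f̃(x, g(x)) is identically zero as a power series in x. -/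
namespace MvPolynomial

variable {σ K L : Type*} [Field K] [Field L] [Algebra K L]

/-- Apply a `K`-linear functional on `L` to every coefficient of a polynomial over `L`. -/
noncomputable def mapDual (φ : L →ₗ[K] K) (f : MvPolynomial σ L) : MvPolynomial σ K :=
  ∑ m ∈ f.support, monomial m (φ (f.coeff m))

theorem coeff_mapDual (φ : L →ₗ[K] K) (f : MvPolynomial σ L) (m : σ →₀ ℕ) :
    (mapDual φ f).coeff m = φ (f.coeff m) := by
  classical
  simp only [mapDual, coeff_sum, coeff_monomial, Finset.sum_ite_eq', mem_support_iff]
  split_ifs with h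
  · rfl
  · rw [not_not.mp h, map_zero]

theorem totalDegree_mapDual_le (φ : L →ₗ[K] K) (f : MvPolynomial σ L) :
    (mapDual φ f).totalDegree ≤ f.totalDegree := by
  refine Finset.sup_mono fun m hm => ?_
  rw [mem_support_iff, coeff_mapDual] at hm
  exact mem_support_iff.mpr fun h => hm (by rw [h, map_zero])

theorem coeff_aeval_mapDual (φ : L →ₗ[K] K) (g : σ → PowerSeries K) (f : MvPolynomial σ L)
    (k : ℕ) :
    PowerSeries.coeff k (aeval g (mapDual φ f)) =
      φ (PowerSeries.coeff k (aeval (fun i => (g i).map (algebraMap K L)) f)) := by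
  conv_rhs => rw [aeval_def, eval₂_eq]
  rw [mapDual]
  simp only [map_sum, aeval_monomial, Finsupp.prod, ← map_pow, ← map_prod,
    PowerSeries.algebraMap_eq, PowerSeries.coeff_C_mul, PowerSeries.coeff_map]
  refine Finset.sum_congr rfl fun m _ => ?_
  rw [mul_comm (f.coeff m), ← Algebra.smul_def, map_smul, smul_eq_mul, mul_comm]

/-- An algebraic relation over an extension field `L` between power series over `K` yields one
over `K` of at most the same total degree. -/
theorem exists_aeval_powerSeries_eq_zero_of_map (g : σ → PowerSeries K) {f : MvPolynomial σ L}
    (hf : f ≠ 0) (hzero : aeval (fun i => (g i).map (algebraMap K L)) f = 0) :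
    ∃ p : MvPolynomial σ K, p ≠ 0 ∧ p.totalDegree ≤ f.totalDegree ∧ aeval g p = 0 := by
  obtain ⟨m, hm⟩ := ne_zero_iff.mp hf
  obtain ⟨φ, hφ⟩ : ∃ φ : L →ₗ[K] K, φ (f.coeff m) ≠ 0 := by
    by_contra! h
    exact hm ((Module.forall_dual_apply_eq_zero_iff K _).mp h)
  refine ⟨mapDual φ f, ne_zero_iff.mpr ⟨m, ?_⟩, totalDegree_mapDual_le φ f, ?_⟩
  · rwa [coeff_mapDual]
  · ext k
    rw [coeff_aeval_mapDual, hzero, map_zero, map_zero, map_zero]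

end MvPolynomial

theorem exists_rational_annihilating_polynomial (a : ℕ → ℚ)
    (hconv : ∃ x : ℝ, 0 < x ∧ Summable fun k => |(a k : ℝ)| * x ^ k)
    (n : ℕ) (f : MvPolynomial (Fin 2) ℂ) (hf : f ≠ 0) (hdeg : f.totalDegree = n)
    (hzero : MvPolynomial.aeval
      ![(PowerSeries.X : PowerSeries ℂ), PowerSeries.mk fun k => (a k : ℂ)] f = 0) :
    ∃ ft : MvPolynomial (Fin 2) ℚ, ft ≠ 0 ∧ ft.totalDegree ≤ n ∧
      MvPolynomial.aeval
        ![(PowerSeries.X : PowerSeries ℚ), PowerSeries.mk fun k => a k] ft = 0 := by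
  subst hdeg
  refine MvPolynomial.exists_aeval_powerSeries_eq_zero_of_map _ hf ?_
  convert hzero using 2
  congr 1
  funext i
  fin_cases i
  · simp
  · ext k
    simp
end

section
/- The set of functions f ∈ ℤ{z} that are algebraic—i.e., for which there exists a nonzero polynomial P ∈ ℂ[x,y] with P(z, f(z)) = 0 for all z ∈ B(0,1)—is countable. -/
open Finset in
theorem hasSum_coeff_mul {F G : PowerSeries ℂ} {z s t : ℂ}
    (hF : HasSum (fun n => PowerSeries.coeff n F * z ^ n) s)
    (hG : HasSum (fun n => PowerSeries.coeff n G * z ^ n) t) :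
    HasSum (fun n => PowerSeries.coeff n (F * G) * z ^ n) (s * t) := by
  have hF' := summable_norm_iff.mpr hF.summable
  have hG' := summable_norm_iff.mpr hG.summable
  have hcoeff : (fun n => PowerSeries.coeff n (F * G) * z ^ n) = fun n =>
      ∑ kl ∈ antidiagonal n,
        (PowerSeries.coeff kl.1 F * z ^ kl.1) * (PowerSeries.coeff kl.2 G * z ^ kl.2) := by
    funext n
    rw [PowerSeries.coeff_mul, sum_mul]
    refine sum_congr rfl fun kl hkl => ?_
    rw [← mem_antidiagonal.mp hkl, pow_add]
    ring
  rw [hcoeff, ← hF.tsum_eq, ← hG.tsum_eq,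
    tsum_mul_tsum_eq_tsum_sum_antidiagonal_of_summable_norm hF' hG']
  exact (summable_norm_sum_mul_antidiagonal_of_summable_norm hF' hG').of_norm.hasSum

theorem hasSum_coeff_C (c z : ℂ) :
    HasSum (fun n => PowerSeries.coeff n (PowerSeries.C c) * z ^ n) c := by
  convert hasSum_single (f := fun n => PowerSeries.coeff n (PowerSeries.C c) * z ^ n) 0 ?_ using 1
  · simp
  · intro n hn
    simp [PowerSeries.coeff_C, hn]

theorem hasSum_coeff_X (z : ℂ) :
    HasSum (fun n => PowerSeries.coeff n (PowerSeries.X : PowerSeries ℂ) * z ^ n) z := by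
  convert hasSum_single
    (f := fun n => PowerSeries.coeff n (PowerSeries.X : PowerSeries ℂ) * z ^ n) 1 ?_ using 1
  · simp
  · intro n hn
    simp [PowerSeries.coeff_X, hn]

theorem hasSum_coeff_eval₂ {σ : Type*} (F : σ → PowerSeries ℂ) {z : ℂ} {s : σ → ℂ}
    (hF : ∀ i, HasSum (fun n => PowerSeries.coeff n (F i) * z ^ n) (s i))
    (P : MvPolynomial σ ℂ) :
    HasSum (fun n => PowerSeries.coeff n (P.eval₂ PowerSeries.C F) * z ^ n)
      (MvPolynomial.eval s P) := by
  induction P using MvPolynomial.induction_on with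
  | C c => simpa using hasSum_coeff_C c z
  | add p q hp hq => simpa [add_mul] using hp.add hq
  | mul_X p i hp => simpa using hasSum_coeff_mul hp (hF i)

theorem PowerSeries.eq_zero_of_hasSum_zero {F : PowerSeries ℂ}
    (h : ∀ z : ℂ, ‖z‖ < 1 → HasSum (fun n => PowerSeries.coeff n F * z ^ n) 0) : F = 0 := by
  have hF : HasFPowerSeriesAt (0 : ℂ → ℂ)
      (FormalMultilinearSeries.ofScalars ℂ fun n => PowerSeries.coeff n F) 0 := by
    rw [hasFPowerSeriesAt_iff]
    filter_upwards [Metric.ball_mem_nhds (0 : ℂ) one_pos] with z hz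
    simpa [FormalMultilinearSeries.coeff_ofScalars, mul_comm] using
      h z (by simpa using hz)
  ext n
  rw [← FormalMultilinearSeries.coeff_ofScalars (p := fun n => PowerSeries.coeff n F) (n := n),
    hF.eq_zero]
  rfl

/-- A rational power series that is algebraic over `ℂ[X]` is algebraic over `ℚ[X]`: apply a
`ℚ`-linear functional `ℂ → ℚ` to the coefficients of an annihilating polynomial. -/
theorem PowerSeries.isAlgebraic_of_eval₂_map_eq_zero {F : PowerSeries ℚ}
    {P : MvPolynomial (Fin 2) ℂ} (hP : P ≠ 0)
    (h : P.eval₂ PowerSeries.C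
      ![PowerSeries.X, PowerSeries.map (algebraMap ℚ ℂ) F] = 0) :
    IsAlgebraic (Polynomial ℚ) F := by
  obtain ⟨e, he⟩ := MvPolynomial.ne_zero_iff.mp hP
  obtain ⟨φ, hφ⟩ : ∃ φ : Module.Dual ℚ ℂ, φ (P.coeff e) ≠ 0 := by
    by_contra! H
    exact he ((Module.forall_dual_apply_eq_zero_iff ℚ _).mp H)
  refine ⟨∑ d ∈ P.support, Polynomial.monomial (d 1)
    (Polynomial.monomial (d 0) (φ (P.coeff d))), fun h0 => hφ ?_, ?_⟩
  · have h1 := congrArg (fun Q => (Q.coeff (e 1)).coeff (e 0)) h0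
    simp only [Polynomial.finsetSum_coeff, Polynomial.coeff_zero] at h1
    rw [Finset.sum_eq_single e] at h1
    · simpa using h1
    · intro d _ hde
      rw [Polynomial.coeff_monomial]
      split_ifs with hd1
      · rw [Polynomial.coeff_monomial, if_neg]
        intro hd0
        refine hde (Finsupp.ext fun i => ?_)
        fin_cases i
        · exact hd0
        · exact hd1
      · simp
    · intro hes
      simp [MvPolynomial.notMem_support_iff.mp hes]
  · ext n
    have hn := congrArg (fun G => φ (PowerSeries.coeff n G)) h
    have hprod (d : Fin 2 →₀ ℕ) : ∏ i, (![PowerSeries.X,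
        PowerSeries.map (algebraMap ℚ ℂ) F] i) ^ d i =
        PowerSeries.map (algebraMap ℚ ℂ) (PowerSeries.X ^ d 0 * F ^ d 1) := by
      simp [Fin.prod_univ_two]
    simp only [MvPolynomial.eval₂_eq', hprod, map_sum, PowerSeries.coeff_C_mul,
      PowerSeries.coeff_map, map_zero] at hn
    rw [map_zero, ← hn, map_sum, map_sum]
    refine Finset.sum_congr rfl fun d _ => ?_
    rw [mul_comm (P.coeff d), ← Algebra.smul_def, map_smul, Polynomial.aeval_monomial,
      PowerSeries.algebraMap_apply', ← Polynomial.C_mul_X_pow_eq_monomial]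
    simp [mul_assoc, PowerSeries.coeff_C_mul, mul_comm (PowerSeries.coeff n _)]

theorem countable_isAlgebraic_powerSeries :
    {F : PowerSeries ℚ | IsAlgebraic (Polynomial ℚ) F}.Countable := by
  have : Countable (Polynomial ℚ) := by
    rw [← Cardinal.mk_le_aleph0_iff]
    exact Polynomial.cardinalMk_le_max.trans (by simp)
  have : FaithfulSMul (Polynomial ℚ) (PowerSeries ℚ) := by
    rw [faithfulSMul_iff_algebraMap_injective]
    intro p q hpq
    simpa [PowerSeries.algebraMap_apply'] using hpq
  exact Algebraic.countable _ _

theorem countable_algebraic_int_coeff_functions :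
    Set.Countable {a : ℕ → ℤ |
      (∀ z : ℂ, ‖z‖ < 1 → Summable fun n => (a n : ℂ) * z ^ n) ∧
      ∃ P : MvPolynomial (Fin 2) ℂ, P ≠ 0 ∧
        ∀ z : ℂ, ‖z‖ < 1 →
          MvPolynomial.eval ![z, ∑' n : ℕ, (a n : ℂ) * z ^ n] P = 0} := by
  have hinj : Function.Injective fun a : ℕ → ℤ => PowerSeries.mk fun n => (a n : ℚ) := by
    intro a b hab
    funext n
    simpa using congrArg (PowerSeries.coeff n) hab
  refine (countable_isAlgebraic_powerSeries.preimage hinj).mono ?_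
  rintro a ⟨ha, P, hP, hPa⟩
  refine PowerSeries.isAlgebraic_of_eval₂_map_eq_zero hP
    (PowerSeries.eq_zero_of_hasSum_zero fun z hz => ?_)
  rw [← hPa z hz]
  refine hasSum_coeff_eval₂ _ (fun i => ?_) P
  fin_cases i
  · exact hasSum_coeff_X z
  · simpa using (ha z hz).hasSum
end

section
/- Let α₁ and α₂ be distinct algebraic numbers of degrees n₁ and n₂, respectively. Then |α₁ − α₂| > (4 n₁ n₂)^{−3 n₁ n₂} · H(α₁)^{−n₂} · H(α₂)^{−n₁}. -/
/-- `p` is the (primitive, positive leading coefficient) minimal polynomial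
over `ℤ` of the algebraic number `β`. -/
def IsIntMinpoly (b : ℂ) (p : Polynomial ℤ) : Prop :=
  0 < p.leadingCoeff ∧ p.IsPrimitive ∧ Polynomial.aeval b p = 0 ∧
    ∀ q : Polynomial ℤ, q ≠ 0 → Polynomial.aeval b q = 0 → p.degree ≤ q.degree

/-- The height of an integer polynomial: the maximum of the absolute values
of its coefficients. -/
noncomputable def polyHeight (p : Polynomial ℤ) : ℝ :=
  (((Finset.range (p.natDegree + 1)).sup fun i => (p.coeff i).natAbs : ℕ) : ℝ)

open Polynomial in
lemma Polynomial.norm_eval_le_of_norm_coeff_le {f : ℂ[X]} {m : ℕ} {c : ℝ}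
    (hf : f.natDegree ≤ m) (hc : ∀ i, ‖f.coeff i‖ ≤ c) (x : ℂ) :
    ‖f.eval x‖ ≤ (m + 1) * c * max 1 ‖x‖ ^ m := by
  rw [eval_eq_sum_range' (Nat.lt_succ_of_le hf)]
  have hterm : ∀ i ∈ Finset.range (m + 1), ‖f.coeff i * x ^ i‖ ≤ c * max 1 ‖x‖ ^ m := by
    intro i hi
    have him : i ≤ m := Nat.lt_succ_iff.mp (Finset.mem_range.mp hi)
    rw [norm_mul, norm_pow]
    refine mul_le_mul (hc i) ?_ (by positivity) ((norm_nonneg _).trans (hc i))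
    exact (pow_le_pow_left₀ (norm_nonneg _) (le_max_right _ _) i).trans
      (pow_le_pow_right₀ (le_max_left _ _) him)
  refine (norm_sum_le_of_le _ hterm).trans_eq ?_
  simp [mul_assoc]

open Polynomial in
lemma Polynomial.norm_eval_le_mahlerMeasure (f : ℂ[X]) (x : ℂ) :
    ‖f.eval x‖ ≤ 2 ^ f.natDegree * f.mahlerMeasure * max 1 ‖x‖ ^ f.natDegree := by
  rw [eval_eq_sum_range]
  have hterm : ∀ i ∈ Finset.range (f.natDegree + 1), ‖f.coeff i * x ^ i‖ ≤
      (f.natDegree.choose i : ℝ) * (f.mahlerMeasure * max 1 ‖x‖ ^ f.natDegree) := by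
    intro i hi
    have him : i ≤ f.natDegree := Nat.lt_succ_iff.mp (Finset.mem_range.mp hi)
    rw [norm_mul, norm_pow, ← mul_assoc]
    refine mul_le_mul (f.norm_coeff_le_choose_mul_mahlerMeasure i) ?_ (by positivity)
      (mul_nonneg (by positivity) f.mahlerMeasure_nonneg)
    exact (pow_le_pow_left₀ (norm_nonneg _) (le_max_right _ _) i).trans
      (pow_le_pow_right₀ (le_max_left _ _) him)
  refine (norm_sum_le_of_le _ hterm).trans_eq ?_
  rw [← Finset.sum_mul, mul_assoc]
  congr 1
  exact_mod_cast Nat.sum_range_choose _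

open Polynomial in
lemma Polynomial.mahlerMeasure_le_X_sub_C_mul (f : ℂ[X]) (y : ℂ) :
    f.mahlerMeasure ≤ ((X - C y) * f).mahlerMeasure := by
  rw [mahlerMeasure_mul, mahlerMeasure_X_sub_C]
  exact le_mul_of_one_le_left f.mahlerMeasure_nonneg (le_max_left _ _)

open Polynomial in
/-- Near a root `y` of `f`, the value of `f` is small, with an explicit constant. -/
lemma Polynomial.norm_eval_le_norm_sub_mul_mahlerMeasure {f : ℂ[X]} {y : ℂ} (hf : f ≠ 0)
    (hy : f.IsRoot y) (x : ℂ) :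
    ‖f.eval x‖ ≤ ‖x - y‖ * 2 ^ (f.natDegree - 1) * f.mahlerMeasure *
      max 1 ‖x‖ ^ f.natDegree := by
  obtain ⟨g, rfl⟩ := dvd_iff_isRoot.mpr hy
  have hg : g ≠ 0 := right_ne_zero_of_mul hf
  have hdeg : ((X - C y) * g).natDegree = g.natDegree + 1 := by
    rw [natDegree_mul (X_sub_C_ne_zero y) hg, natDegree_X_sub_C, add_comm]
  rw [hdeg, Nat.add_sub_cancel, eval_mul, norm_mul]
  simp only [eval_sub, eval_X, eval_C, mul_assoc]
  have hmax : max 1 ‖x‖ ^ g.natDegree ≤ max 1 ‖x‖ ^ (g.natDegree + 1) :=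
    pow_le_pow_right₀ (le_max_left _ _) (Nat.le_succ _)
  refine mul_le_mul_of_nonneg_left ?_ (norm_nonneg _)
  rw [← mul_assoc]
  refine (g.norm_eval_le_mahlerMeasure x).trans ?_
  have := g.mahlerMeasure_nonneg
  have := ((X - C y) * g).mahlerMeasure_nonneg
  gcongr
  exact g.mahlerMeasure_le_X_sub_C_mul y

open Polynomial in
lemma Polynomial.one_le_norm_leadingCoeff_pow_mul_prod_eval {p q : ℤ[X]}
    (hpq : IsCoprime (p.map (Int.castRingHom ℂ)) (q.map (Int.castRingHom ℂ))) :
    1 ≤ ‖(p.map (Int.castRingHom ℂ)).leadingCoeff‖ ^ q.natDegree *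
      ((p.map (Int.castRingHom ℂ)).roots.map
        fun y ↦ ‖(q.map (Int.castRingHom ℂ)).eval y‖).prod := by
  have hinj : Function.Injective (Int.castRingHom ℂ) :=
    (Int.castRingHom ℂ).injective_int
  have hres := resultant_ne_zero _ _ hpq
  have heval := resultant_eq_prod_eval (p.map (Int.castRingHom ℂ)) (q.map (Int.castRingHom ℂ))
    (q.map (Int.castRingHom ℂ)).natDegree le_rfl (IsAlgClosed.splits _)
  have hnorm : ∀ s : Multiset ℂ, ‖s.prod‖ = (s.map fun y ↦ ‖y‖).prod := fun s ↦
    map_multiset_prod (normHom : ℂ →*₀ ℝ) s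
  have hint : 1 ≤ ‖resultant (p.map (Int.castRingHom ℂ)) (q.map (Int.castRingHom ℂ))‖ := by
    rw [resultant_map_map] at hres ⊢
    rw [eq_intCast, Int.cast_ne_zero] at hres
    rw [eq_intCast, Complex.norm_intCast]
    exact_mod_cast Int.one_le_abs hres
  rwa [heval, norm_mul, norm_pow, hnorm, Multiset.map_map,
    natDegree_map_eq_of_injective hinj] at hint

open Polynomial in
/-- A Liouville-type bound: the resultant of two coprime integer polynomials `p` and `q` has
absolute value at least `1`, while it is small if `q` is small at one of the roots of `p`. -/
lemma Polynomial.one_le_mul_pow_mul_mahlerMeasure_pow {p q : ℤ[X]} {x : ℂ} {E B : ℝ}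
    (hpq : IsCoprime (p.map (Int.castRingHom ℂ)) (q.map (Int.castRingHom ℂ)))
    (hx : x ∈ (p.map (Int.castRingHom ℂ)).roots)
    (hE : ‖(q.map (Int.castRingHom ℂ)).eval x‖ ≤ E * max 1 ‖x‖ ^ q.natDegree)
    (hB : ∀ y, ‖(q.map (Int.castRingHom ℂ)).eval y‖ ≤ B * max 1 ‖y‖ ^ q.natDegree) :
    1 ≤ E * B ^ (p.natDegree - 1) * (p.map (Int.castRingHom ℂ)).mahlerMeasure ^ q.natDegree := by
  have hmain := one_le_norm_leadingCoeff_pow_mul_prod_eval hpq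
  have hcard : (p.map (Int.castRingHom ℂ)).roots.card = p.natDegree := by
    rw [← (IsAlgClosed.splits _).natDegree_eq_card_roots,
      natDegree_map_eq_of_injective (Int.castRingHom ℂ).injective_int]
  rw [mahlerMeasure_eq_leadingCoeff_mul_prod_roots, mul_pow]
  obtain ⟨s, hs⟩ := Multiset.exists_cons_of_mem hx
  rw [hs, Multiset.card_cons] at hcard
  rw [hs, Multiset.map_cons, Multiset.prod_cons] at hmain ⊢
  have hprod : (s.map fun y ↦ ‖(q.map (Int.castRingHom ℂ)).eval y‖).prod ≤
      B ^ (p.natDegree - 1) * (s.map fun y ↦ max 1 ‖y‖).prod ^ q.natDegree := by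
    refine (Multiset.prod_map_le_prod_map₀ _ (fun y ↦ B * max 1 ‖y‖ ^ q.natDegree)
      (fun y _ ↦ norm_nonneg _) fun y _ ↦ hB y).trans_eq ?_
    rw [Multiset.prod_map_mul, Multiset.prod_map_pow, Multiset.map_const', Multiset.prod_replicate,
      ← hcard, Nat.add_sub_cancel]
  calc
    1 ≤ _ := hmain
    _ ≤ ‖(p.map (Int.castRingHom ℂ)).leadingCoeff‖ ^ q.natDegree *
        (E * max 1 ‖x‖ ^ q.natDegree *
          (B ^ (p.natDegree - 1) * (s.map fun y ↦ max 1 ‖y‖).prod ^ q.natDegree)) := by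
      refine mul_le_mul_of_nonneg_left (mul_le_mul hE hprod ?_ ((norm_nonneg _).trans hE))
        (by positivity)
      exact Multiset.prod_map_nonneg fun y _ ↦ norm_nonneg _
    _ = _ := by ring

lemma norm_coeff_le_polyHeight (p : Polynomial ℤ) (i : ℕ) :
    ‖(p.map (Int.castRingHom ℂ)).coeff i‖ ≤ polyHeight p := by
  rw [Polynomial.coeff_map, eq_intCast, Complex.norm_intCast, ← Int.cast_abs, Int.abs_eq_natAbs,
    Int.cast_natCast, polyHeight, Nat.cast_le]
  rcases lt_or_ge p.natDegree i with h | h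
  · simp [Polynomial.coeff_eq_zero_of_natDegree_lt h]
  · exact Finset.le_sup (f := fun i ↦ (p.coeff i).natAbs)
      (Finset.mem_range.mpr (Nat.lt_succ_of_le h))

lemma one_le_polyHeight {p : Polynomial ℤ} (hp : p ≠ 0) : 1 ≤ polyHeight p := by
  refine le_trans ?_ (norm_coeff_le_polyHeight p p.natDegree)
  rw [Polynomial.coeff_map, eq_intCast, Complex.norm_intCast]
  exact_mod_cast Int.one_le_abs (Polynomial.leadingCoeff_ne_zero.mpr hp)

lemma mahlerMeasure_le_polyHeight (p : Polynomial ℤ) :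
    (p.map (Int.castRingHom ℂ)).mahlerMeasure ≤ (p.natDegree + 1) * polyHeight p := by
  refine (Polynomial.mahlerMeasure_le_sum_norm_coeff _).trans ?_
  rw [Polynomial.sum_over_range' _ (by simp) (p.natDegree + 1)
    (Nat.lt_succ_of_le Polynomial.natDegree_map_le)]
  refine (Finset.sum_le_sum fun i _ ↦ norm_coeff_le_polyHeight p i).trans_eq ?_
  simp

lemma Polynomial.isCoprime_map_complex_of_map_rat {p q : Polynomial ℤ}
    (h : IsCoprime (p.map (Int.castRingHom ℚ)) (q.map (Int.castRingHom ℚ))) :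
    IsCoprime (p.map (Int.castRingHom ℂ)) (q.map (Int.castRingHom ℂ)) := by
  have := h.map (Polynomial.mapRingHom (algebraMap ℚ ℂ))
  simpa only [Polynomial.coe_mapRingHom, Polynomial.map_map,
    RingHom.ext_int ((algebraMap ℚ ℂ).comp (Int.castRingHom ℚ)) (Int.castRingHom ℂ)] using this

namespace IsIntMinpoly

variable {b : ℂ} {p : Polynomial ℤ}

lemma ne_zero (h : IsIntMinpoly b p) : p ≠ 0 :=
  Polynomial.leadingCoeff_ne_zero.mp h.1.ne'

lemma isRoot (h : IsIntMinpoly b p) : (p.map (Int.castRingHom ℂ)).IsRoot b := by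
  have := h.2.2.1
  rwa [Polynomial.aeval_def, ← Polynomial.eval_map] at this

lemma map_ne_zero (h : IsIntMinpoly b p) : p.map (Int.castRingHom ℂ) ≠ 0 :=
  (Polynomial.map_ne_zero_iff (Int.castRingHom ℂ).injective_int).mpr h.ne_zero

lemma natDegree_pos (h : IsIntMinpoly b p) : 0 < p.natDegree := by
  rw [← Polynomial.natDegree_map_eq_of_injective (Int.castRingHom ℂ).injective_int p]
  exact Polynomial.natDegree_pos_of_eval₂_root h.map_ne_zero (RingHom.id ℂ) h.isRoot fun _ hx ↦ hx

open Polynomial in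
lemma irreducible_map (h : IsIntMinpoly b p) : Irreducible (p.map (Int.castRingHom ℚ)) := by
  have hp0 : p.map (Int.castRingHom ℚ) ≠ 0 :=
    (Polynomial.map_ne_zero_iff (Int.castRingHom ℚ).injective_int).mpr h.ne_zero
  have hlc : (p.map (Int.castRingHom ℚ)).leadingCoeff⁻¹ ≠ 0 :=
    inv_ne_zero (leadingCoeff_ne_zero.mpr hp0)
  have hroot : aeval b (p.map (Int.castRingHom ℚ)) = 0 := by
    have := h.2.2.1
    rwa [← aeval_map_algebraMap ℚ] at this
  have hint : IsIntegral ℚ b := IsAlgebraic.isIntegral ⟨_, hp0, hroot⟩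
  have hmin : p.map (Int.castRingHom ℚ) * C (p.map (Int.castRingHom ℚ)).leadingCoeff⁻¹ =
      minpoly ℚ b := by
    refine minpoly.unique ℚ b (monic_mul_leadingCoeff_inv hp0) (by simp [hroot]) fun q hq hqb ↦ ?_
    rw [degree_mul_C hlc, degree_map_eq_of_injective (Int.castRingHom ℚ).injective_int]
    obtain ⟨c, hc, hcq⟩ := IsLocalization.integerNormalization_spec (nonZeroDivisors ℤ) q
    set r := IsLocalization.integerNormalization (nonZeroDivisors ℤ) q
    have hrq : r.map (algebraMap ℤ ℚ) = C (c : ℚ) * q := by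
      rw [hcq, ← smul_eq_C_mul, Int.cast_smul_eq_zsmul]
    have hc0 : (c : ℚ) ≠ 0 := Int.cast_ne_zero.mpr (nonZeroDivisors.ne_zero hc)
    have hr0 : r ≠ 0 := by
      intro hr
      rw [hr, Polynomial.map_zero] at hrq
      exact mul_ne_zero (C_ne_zero.mpr hc0) hq.ne_zero hrq.symm
    have hrb : aeval b r = 0 :=
      IsLocalization.integerNormalization_aeval_eq_zero (nonZeroDivisors ℤ) q hqb
    refine (h.2.2.2 r hr0 hrb).trans_eq ?_
    rw [← degree_map_eq_of_injective (algebraMap ℤ ℚ).injective_int, hrq, degree_C_mul hc0]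
  have hirr := minpoly.irreducible hint
  rw [← hmin] at hirr
  exact (irreducible_mul_isUnit (isUnit_C.mpr hlc.isUnit)).mp hirr

lemma isCoprime_derivative (h : IsIntMinpoly b p) :
    IsCoprime (p.map (Int.castRingHom ℂ)) (p.derivative.map (Int.castRingHom ℂ)) := by
  refine Polynomial.isCoprime_map_complex_of_map_rat ?_
  rw [← Polynomial.derivative_map]
  exact h.irreducible_map.separable

lemma isCoprime_of_ne {b' : ℂ} {p' : Polynomial ℤ} (h : IsIntMinpoly b p)
    (h' : IsIntMinpoly b' p') (hne : p ≠ p') :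
    IsCoprime (p.map (Int.castRingHom ℂ)) (p'.map (Int.castRingHom ℂ)) := by
  refine Polynomial.isCoprime_map_complex_of_map_rat
    (h.irreducible_map.coprime_iff_not_dvd.mpr fun hdvd ↦ hne ?_)
  have hdvd' := (h.irreducible_map.dvd_symm h'.irreducible_map) hdvd
  rw [← Polynomial.IsPrimitive.Int.dvd_iff_map_cast_dvd_map_cast _ _ h.2.1] at hdvd
  rw [← Polynomial.IsPrimitive.Int.dvd_iff_map_cast_dvd_map_cast _ _ h'.2.1] at hdvd'
  obtain ⟨u, hu⟩ := associated_of_dvd_dvd hdvd hdvd'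
  obtain ⟨r, hr, hru⟩ := Polynomial.isUnit_iff.mp u.isUnit
  have hlc : p'.leadingCoeff = p.leadingCoeff * r := by
    rw [← hu, ← hru, Polynomial.leadingCoeff_mul, Polynomial.leadingCoeff_C]
  have hr0 : 0 < r := pos_of_mul_pos_right (hlc ▸ h'.1) h.1.le
  rcases Int.isUnit_iff.mp hr with rfl | rfl
  · simpa [← hru] using hu
  · norm_num at hr0

end IsIntMinpoly

lemma two_pow_mul_lt_four_mul_pow {m n : ℕ} (hm : 0 < m) (hn : 0 < n) :
    2 ^ (n - 1) * (n + 1) ^ m * (m + 1) ^ n < (4 * m * n) ^ (3 * m * n) := by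
  have hmn : 0 < m * n := Nat.mul_pos hm hn
  have hm' : m ≤ m * n := Nat.le_mul_of_pos_right m hn
  have hn' : n ≤ m * n := Nat.le_mul_of_pos_left n hm
  have h1 : 2 ^ (n - 1) < 2 ^ (m * n) := Nat.pow_lt_pow_right (by norm_num) (by lia)
  have h2 : (n + 1) ^ m ≤ (2 * (m * n)) ^ (m * n) :=
    (Nat.pow_le_pow_left (by lia) m).trans (Nat.pow_le_pow_right (by lia) hm')
  have h3 : (m + 1) ^ n ≤ (2 * (m * n)) ^ (m * n) :=
    (Nat.pow_le_pow_left (by lia) n).trans (Nat.pow_le_pow_right (by lia) hn')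
  calc
    _ ≤ 2 ^ (n - 1) * (2 * (m * n)) ^ (m * n) * (2 * (m * n)) ^ (m * n) := by gcongr
    _ < 2 ^ (m * n) * (2 * (m * n)) ^ (m * n) * (2 * (m * n)) ^ (m * n) := by gcongr
    _ = (2 * (2 * (m * n)) * (2 * (m * n))) ^ (m * n) := by rw [← mul_pow, ← mul_pow]
    _ ≤ ((4 * m * n) ^ 3) ^ (m * n) := by
      refine Nat.pow_le_pow_left ?_ _
      have : (m * n) ^ 2 ≤ (m * n) ^ 3 := Nat.pow_le_pow_right hmn (by norm_num)
      nlinarith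
    _ = _ := by rw [← pow_mul, mul_assoc 3]

lemma two_pow_mul_sq_pow_lt_four_mul_pow {n : ℕ} (hn : 0 < n) :
    2 ^ (n - 1 - 1) * (n + 1) ^ n * (n * n) ^ (n - 1) < (4 * n * n) ^ (3 * n * n) := by
  have hnn : n ≤ n * n := Nat.le_mul_of_pos_left n hn
  have h1 : 2 ^ (n - 1 - 1) < 2 ^ (n * n) := Nat.pow_lt_pow_right (by norm_num) (by lia)
  have h2 : (n + 1) ^ n ≤ (2 * (n * n)) ^ (n * n) :=
    (Nat.pow_le_pow_left (by lia) n).trans (Nat.pow_le_pow_right (by lia) hnn)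
  have h3 : (n * n) ^ (n - 1) ≤ (n * n) ^ (n * n) := Nat.pow_le_pow_right (by lia) (by lia)
  calc
    _ ≤ 2 ^ (n - 1 - 1) * (2 * (n * n)) ^ (n * n) * (n * n) ^ (n * n) := by gcongr
    _ < 2 ^ (n * n) * (2 * (n * n)) ^ (n * n) * (n * n) ^ (n * n) := by gcongr
    _ = (2 * (2 * (n * n)) * (n * n)) ^ (n * n) := by rw [← mul_pow, ← mul_pow]
    _ ≤ ((4 * n * n) ^ 3) ^ (n * n) := by
      refine Nat.pow_le_pow_left ?_ _
      have : (n * n) ^ 2 ≤ (n * n) ^ 3 := Nat.pow_le_pow_right (by lia) (by norm_num)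
      nlinarith
    _ = _ := by rw [← pow_mul, mul_assoc 3]

namespace IsIntMinpoly

open Polynomial

variable {a b : ℂ} {p q : ℤ[X]}

lemma one_le_norm_sub_mul_of_ne (h : IsIntMinpoly a p) (h' : IsIntMinpoly b q) (hne : p ≠ q) :
    1 ≤ ‖a - b‖ * (2 ^ (q.natDegree - 1) * (q.natDegree + 1) ^ p.natDegree *
      (p.natDegree + 1) ^ q.natDegree) *
      (polyHeight p ^ q.natDegree * polyHeight q ^ p.natDegree) := by
  have hdeg := natDegree_map_eq_of_injective (Int.castRingHom ℂ).injective_int q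
  have hE := norm_eval_le_norm_sub_mul_mahlerMeasure h'.map_ne_zero h'.isRoot a
  rw [hdeg] at hE
  have hbound := one_le_mul_pow_mul_mahlerMeasure_pow (h.isCoprime_of_ne h' hne)
    ((mem_roots h.map_ne_zero).mpr h.isRoot) hE
    (norm_eval_le_of_norm_coeff_le hdeg.le (norm_coeff_le_polyHeight q))
  have hp := one_le_polyHeight h.ne_zero
  have hq := one_le_polyHeight h'.ne_zero
  have hMp := mahlerMeasure_le_polyHeight p
  have hMq := mahlerMeasure_le_polyHeight q
  have := (p.map (Int.castRingHom ℂ)).mahlerMeasure_nonneg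
  have := (q.map (Int.castRingHom ℂ)).mahlerMeasure_nonneg
  calc
    1 ≤ _ := hbound
    _ ≤ ‖a - b‖ * 2 ^ (q.natDegree - 1) * ((q.natDegree + 1) * polyHeight q) *
        ((q.natDegree + 1) * polyHeight q) ^ (p.natDegree - 1) *
        ((p.natDegree + 1) * polyHeight p) ^ q.natDegree := by gcongr
    _ = ‖a - b‖ * 2 ^ (q.natDegree - 1) *
        (((q.natDegree + 1) * polyHeight q) ^ (p.natDegree - 1) *
          ((q.natDegree + 1) * polyHeight q)) *
        ((p.natDegree + 1) * polyHeight p) ^ q.natDegree := by ring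
    _ = _ := by
      rw [pow_sub_one_mul h.natDegree_pos.ne', mul_pow, mul_pow]
      ring

lemma norm_coeff_derivative_le_polyHeight (p : ℤ[X]) (i : ℕ) :
    ‖(p.derivative.map (Int.castRingHom ℂ)).coeff i‖ ≤ p.natDegree * polyHeight p := by
  rw [← derivative_map, coeff_derivative]
  have hp : 0 ≤ polyHeight p := Nat.cast_nonneg _
  rcases lt_or_ge i p.natDegree with hi | hi
  · rw [norm_mul, mul_comm]
    refine mul_le_mul ?_ (norm_coeff_le_polyHeight p _) (norm_nonneg _) (by positivity)
    have hi' : ((i + 1 : ℕ) : ℝ) ≤ p.natDegree := Nat.cast_le.mpr hi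
    rwa [← Nat.cast_succ, Complex.norm_natCast]
  · rw [coeff_map, coeff_eq_zero_of_natDegree_lt (Nat.lt_succ_of_le hi)]
    simp only [map_zero, zero_mul, norm_zero]
    positivity

lemma one_le_norm_sub_mul_of_conjugate (h : IsIntMinpoly a p) (h' : IsIntMinpoly b p)
    (hab : a ≠ b) :
    1 ≤ ‖a - b‖ * (2 ^ (p.natDegree - 1 - 1) * (p.natDegree + 1) ^ p.natDegree *
      (p.natDegree * p.natDegree) ^ (p.natDegree - 1)) *
      (polyHeight p ^ p.natDegree * polyHeight p ^ p.natDegree) := by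
  have hdeg := natDegree_map_eq_of_injective (Int.castRingHom ℂ).injective_int p
  have hdeg' : p.derivative.natDegree = p.natDegree - 1 := natDegree_derivative p
  have hH := one_le_polyHeight h.ne_zero
  have hM := mahlerMeasure_le_polyHeight p
  have hM0 := (p.map (Int.castRingHom ℂ)).mahlerMeasure_nonneg
  have hn := h.natDegree_pos
  obtain ⟨g, hg⟩ := dvd_iff_isRoot.mpr h.isRoot
  have hg0 : g ≠ 0 := right_ne_zero_of_mul (hg ▸ h.map_ne_zero)
  have hgdeg : g.natDegree = p.natDegree - 1 := by
    rw [← hdeg, hg, natDegree_mul (X_sub_C_ne_zero a) hg0, natDegree_X_sub_C,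
      Nat.add_sub_cancel_left]
  have hgb : g.IsRoot b := by
    have := h'.isRoot
    rw [hg, root_mul, root_X_sub_C] at this
    exact this.resolve_left hab
  have hga : (p.derivative.map (Int.castRingHom ℂ)).eval a = g.eval a := by
    rw [← derivative_map, hg]
    simp [derivative_mul]
  have hE := norm_eval_le_norm_sub_mul_mahlerMeasure hg0 hgb a
  rw [← hga, hgdeg] at hE
  have hgM : g.mahlerMeasure ≤ (p.natDegree + 1) * polyHeight p :=
    (hg ▸ g.mahlerMeasure_le_X_sub_C_mul a).trans hM
  have hB := norm_eval_le_of_norm_coeff_le (natDegree_map_le.trans_eq hdeg')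
    (norm_coeff_derivative_le_polyHeight p)
  rw [← hdeg'] at hE hB
  have hbound := one_le_mul_pow_mul_mahlerMeasure_pow h.isCoprime_derivative
    ((mem_roots h.map_ne_zero).mpr h.isRoot) hE hB
  rw [hdeg'] at hbound
  have hcast : ((p.natDegree - 1 : ℕ) : ℝ) + 1 = p.natDegree := by
    rw [Nat.cast_sub hn, Nat.cast_one, sub_add_cancel]
  rw [hcast] at hbound
  calc
    1 ≤ _ := hbound
    _ ≤ ‖a - b‖ * 2 ^ (p.natDegree - 1 - 1) * ((p.natDegree + 1) * polyHeight p) *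
        (p.natDegree * (p.natDegree * polyHeight p)) ^ (p.natDegree - 1) *
        ((p.natDegree + 1) * polyHeight p) ^ (p.natDegree - 1) := by gcongr
    _ = ‖a - b‖ * 2 ^ (p.natDegree - 1 - 1) *
        ((p.natDegree * p.natDegree) ^ (p.natDegree - 1) * polyHeight p ^ (p.natDegree - 1)) *
        (((p.natDegree + 1) * polyHeight p) ^ (p.natDegree - 1) *
          ((p.natDegree + 1) * polyHeight p)) := by
      rw [← mul_pow]
      ring
    _ = ‖a - b‖ * (2 ^ (p.natDegree - 1 - 1) * (p.natDegree + 1) ^ p.natDegree *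
        (p.natDegree * p.natDegree) ^ (p.natDegree - 1)) *
        (polyHeight p ^ (p.natDegree - 1) * polyHeight p ^ p.natDegree) := by
      rw [pow_sub_one_mul hn.ne', mul_pow ((p.natDegree : ℝ) + 1)]
      ring
    _ ≤ _ := by
      gcongr
      exact Nat.sub_le _ _

end IsIntMinpoly

theorem bombieri_liouville_inequality (a1 a2 : ℂ) (p1 p2 : Polynomial ℤ) (n1 n2 : ℕ)
    (h1 : IsIntMinpoly a1 p1) (h2 : IsIntMinpoly a2 p2)
    (hd1 : p1.natDegree = n1) (hd2 : p2.natDegree = n2) (hne : a1 ≠ a2) :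
    (4 * n1 * n2 : ℝ) ^ (-(3 * n1 * n2 : ℤ)) * polyHeight p1 ^ (-(n2 : ℤ)) *
      polyHeight p2 ^ (-(n1 : ℤ)) < ‖a1 - a2‖ := by
  have hn1 : 0 < n1 := hd1 ▸ h1.natDegree_pos
  have hn2 : 0 < n2 := hd2 ▸ h2.natDegree_pos
  have hH1 : 0 < polyHeight p1 := zero_lt_one.trans_le (one_le_polyHeight h1.ne_zero)
  have hH2 : 0 < polyHeight p2 := zero_lt_one.trans_le (one_le_polyHeight h2.ne_zero)
  have hdist : 0 < ‖a1 - a2‖ := norm_pos_iff.mpr (sub_ne_zero.mpr hne)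
  obtain ⟨K, hK, hbound⟩ : ∃ K : ℝ, K < (4 * n1 * n2 : ℝ) ^ (3 * n1 * n2) ∧
      1 ≤ ‖a1 - a2‖ * K * (polyHeight p1 ^ n2 * polyHeight p2 ^ n1) := by
    subst hd1 hd2
    by_cases hp : p1 = p2
    · subst hp
      refine ⟨_, ?_, h1.one_le_norm_sub_mul_of_conjugate h2 hne⟩
      exact_mod_cast two_pow_mul_sq_pow_lt_four_mul_pow hn1
    · refine ⟨_, ?_, h1.one_le_norm_sub_mul_of_ne h2 hp⟩
      exact_mod_cast two_pow_mul_lt_four_mul_pow hn1 hn2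
  have hexp : (3 * n1 * n2 : ℤ) = ((3 * n1 * n2 : ℕ) : ℤ) := by push_cast; rfl
  rw [hexp, zpow_neg, zpow_neg, zpow_neg, zpow_natCast, zpow_natCast, zpow_natCast, mul_assoc,
    ← mul_inv, ← mul_inv, inv_lt_iff_one_lt_mul₀' (by positivity)]
  calc
    1 ≤ _ := hbound
    _ < ‖a1 - a2‖ * (4 * n1 * n2 : ℝ) ^ (3 * n1 * n2) *
        (polyHeight p1 ^ n2 * polyHeight p2 ^ n1) := by gcongr
    _ = _ := by ring
end
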